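/- Let n, m ≥ 1 and let Ω = {x ∈ ℝ^{n+1} : 1 < ‖x‖ < 2} be the open annulus, with ∂Ω = S^n(1) ∪ S^n(2) the spheres of radii 1 and 2. Let f₁ and f₂ be C² maps defined on open neighborhoods of S^n(1) and S^n(2) respectively, with values in ℝ^{m+1}, such that there are integers l₁, l₂ < n with rank(d(f_i)_x) ≤ l_i for all x in the respective sphere (this holds when the images are manifolds of dimension lower than n), and such that the images f₁(S^n(1)) and f₂(S^n(2)) are disjoint. Then there exists R₀ > 0 such that for every R ≥ R₀ there is no solution of the Dirichlet problem for the minimal surface system on Ω whose boundary data equals R·f₁ on S^n(1) and R·f₂ on S^n(2). -/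

import Mathlib

open MeasureTheory

/-- The induced metric `g_{ij} = δ_{ij} + Σ_α ∂_i F^α ∂_j F^α` of the graph of `F`
(using the a.e.-defined total `fderiv`). -/
noncomputable def mssMetric {n m : ℕ}
    (F : EuclideanSpace ℝ (Fin (n+1)) → EuclideanSpace ℝ (Fin (m+1)))
    (x : EuclideanSpace ℝ (Fin (n+1))) : Matrix (Fin (n+1)) (Fin (n+1)) ℝ :=
  fun i j => (if i = j then (1:ℝ) else 0) +
    ∑ α : Fin (m+1),
      fderiv ℝ F x (EuclideanSpace.single i 1) α * fderiv ℝ F x (EuclideanSpace.single j 1) α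

/-- `F` is a solution of the Dirichlet problem for the minimal surface system on `Ω`
with boundary data `f`: continuous on `closure Ω`, Lipschitz on `Ω`, equal to `f` on `∂Ω`,
and weakly satisfying the minimal surface system. -/
def IsMSSolution (n m : ℕ) (Ω : Set (EuclideanSpace ℝ (Fin (n+1))))
    (f F : EuclideanSpace ℝ (Fin (n+1)) → EuclideanSpace ℝ (Fin (m+1))) : Prop :=
  ContinuousOn F (closure Ω) ∧
  (∃ K : NNReal, LipschitzOnWith K F Ω) ∧
  (∀ x ∈ frontier Ω, F x = f x) ∧
  (∀ φ : EuclideanSpace ℝ (Fin (n+1)) → ℝ, ContDiff ℝ (⊤ : ℕ∞) φ → HasCompactSupport φ →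
     tsupport φ ⊆ Ω →
     (∀ j : Fin (n+1),
        ∫ x in Ω, (∑ i : Fin (n+1),
          Real.sqrt (mssMetric F x).det * (mssMetric F x)⁻¹ i j *
            fderiv ℝ φ x (EuclideanSpace.single i 1)) = 0) ∧
     (∀ α : Fin (m+1),
        ∫ x in Ω, (∑ i : Fin (n+1), ∑ j : Fin (n+1),
          Real.sqrt (mssMetric F x).det * (mssMetric F x)⁻¹ i j *
            fderiv ℝ F x (EuclideanSpace.single j 1) α *
            fderiv ℝ φ x (EuclideanSpace.single i 1)) = 0))

section Mollification

open scoped Convolution NNReal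
open Filter Topology Set

lemma lineDeriv_comp_const_sub {E : Type*} [NormedAddCommGroup E] [NormedSpace ℝ E] (ψ : E → ℝ)
    (x t v : E) :
    lineDeriv ℝ (fun s => ψ (x - s)) t (-v) = lineDeriv ℝ ψ (x - t) v := by
  simp only [lineDeriv]
  congr 1
  ext s
  congr 1
  module

variable {E : Type*} [NormedAddCommGroup E] [NormedSpace ℝ E] [FiniteDimensional ℝ E]
  [MeasurableSpace E] [BorelSpace E] {μ : Measure E} [μ.IsAddHaarMeasure]

lemma LipschitzWith.fderiv_normed_convolution_apply {K : ℝ≥0} {ψ : E → ℝ} (hψ : LipschitzWith K ψ)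
    (hc : HasCompactSupport ψ) (ρ : ContDiffBump (0 : E)) (x v : E) :
    fderiv ℝ (ρ.normed μ ⋆[ContinuousLinearMap.lsmul ℝ ℝ, μ] ψ) x v =
      (ρ.normed μ ⋆[ContinuousLinearMap.lsmul ℝ ℝ, μ] fun y => lineDeriv ℝ ψ y v) x := by
  have hρ : ContDiff ℝ 1 (ρ.normed μ) := ρ.contDiff_normed
  have hcρ : HasCompactSupport (ρ.normed μ) := ρ.hasCompactSupport_normed
  have hloc : LocallyIntegrable ψ μ := hψ.continuous.locallyIntegrable
  rw [(hcρ.hasFDerivAt_convolution_left (ContinuousLinearMap.lsmul ℝ ℝ) hρ hloc x).fderiv]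
  have hint : ConvolutionExistsAt (fderiv ℝ (ρ.normed μ)) ψ x
      ((ContinuousLinearMap.lsmul ℝ ℝ).precompL E) μ :=
    ((hcρ.fderiv ℝ).convolutionExists_left _ (hρ.continuous_fderiv one_ne_zero) hloc) x
  rw [convolution_def, ContinuousLinearMap.integral_apply hint.integrable, convolution_def]
  obtain ⟨D, hD⟩ : ∃ D, LipschitzWith D (ρ.normed μ) := hρ.lipschitzWith_of_hasCompactSupport hcρ one_ne_zero
  have hψ' : LipschitzWith K fun s => ψ (x - s) := by
    have h1 : LipschitzWith 1 fun s : E => x - s :=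
      LipschitzWith.of_dist_le_mul fun a b => by
        rw [NNReal.coe_one, one_mul, dist_sub_left]
    simpa [Function.comp_def] using hψ.comp h1
  have hc' : HasCompactSupport fun s => ψ (x - s) :=
    hc.comp_homeomorph (Homeomorph.subLeft x)
  have key := hD.integral_lineDeriv_mul_eq (μ := μ) hψ' hc' v
  calc _ = ∫ t, lineDeriv ℝ (ρ.normed μ) t v * ψ (x - t) ∂μ := by
        congr 1; ext t
        rw [((hρ.differentiable one_ne_zero) t).lineDeriv_eq_fderiv]
        simp [ContinuousLinearMap.precompL_apply]
    _ = _ := by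
        rw [key]
        congr 1; ext t
        rw [lineDeriv_comp_const_sub]
        simp [mul_comm]

/-- A compactly supported Lipschitz function supported in an open set is a limit of smooth
compactly supported functions in that set, with gradients converging almost everywhere and
uniformly bounded. -/
lemma LipschitzWith.exists_smooth_approx {K : ℝ≥0} {ψ : E → ℝ} (hψ : LipschitzWith K ψ)
    (hc : HasCompactSupport ψ) {U : Set E} (hU : IsOpen U) (hψU : tsupport ψ ⊆ U) :
    ∃ φ : ℕ → E → ℝ, (∀ k, ContDiff ℝ (⊤ : ℕ∞) (φ k)) ∧ (∀ k, HasCompactSupport (φ k)) ∧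
      (∀ k, tsupport (φ k) ⊆ U) ∧ (∀ k x v, |fderiv ℝ (φ k) x v| ≤ K * ‖v‖) ∧
      ∀ v, ∀ᵐ x ∂μ, Tendsto (fun k => fderiv ℝ (φ k) x v) atTop (𝓝 (fderiv ℝ ψ x v)) := by
  obtain ⟨δ, hδ, hδU⟩ := hc.isCompact.exists_cthickening_subset_open hU hψU
  let ρ : ℕ → ContDiffBump (0 : E) := fun k =>
    ⟨δ / (k + 1) / 2, δ / (k + 1), by positivity, half_lt_self (by positivity)⟩
  have hloc : LocallyIntegrable ψ μ := hψ.continuous.locallyIntegrable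
  have hts : ∀ k, tsupport ((ρ k).normed μ ⋆[ContinuousLinearMap.lsmul ℝ ℝ, μ] ψ) ⊆
      Metric.cthickening δ (tsupport ψ) := by
    intro k
    refine closure_minimal ?_ Metric.isClosed_cthickening
    refine (support_convolution_subset _).trans ?_
    rintro _ ⟨a, ha, b, hb, rfl⟩
    rw [(ρ k).support_normed_eq] at ha
    refine Metric.mem_cthickening_of_dist_le _ b _ _ (subset_tsupport _ hb) ?_
    have : ‖a‖ < δ / (k + 1) := by simpa [ρ] using ha
    have h2 : δ / (k + 1) ≤ δ := div_le_self hδ.le (by linarith [(Nat.cast_nonneg k : (0:ℝ) ≤ k)])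
    simp only [dist_eq_norm, add_sub_cancel_right]
    linarith
  have hld : ∀ x v, ‖lineDeriv ℝ ψ x v‖ ≤ K * ‖v‖ := fun x v =>
    norm_lineDeriv_le_of_lipschitz ℝ hψ
  have hldm : ∀ v, Measurable fun x => lineDeriv ℝ ψ x v := fun v =>
    measurable_lineDeriv hψ.continuous
  refine ⟨fun k => (ρ k).normed μ ⋆[ContinuousLinearMap.lsmul ℝ ℝ, μ] ψ, fun k => ?_, fun k => ?_,
    fun k => (hts k).trans hδU, fun k x v => ?_, fun v => ?_⟩
  · exact (ρ k).hasCompactSupport_normed.contDiff_convolution_left _ (ρ k).contDiff_normed hloc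
  · exact (ρ k).hasCompactSupport_normed.convolution _ hc
  · rw [hψ.fderiv_normed_convolution_apply hc, convolution_def, ← Real.norm_eq_abs]
    have hi := ((ρ k).integrable_normed (μ := μ)).mul_const (K * ‖v‖)
    refine (norm_integral_le_of_norm_le hi (Eventually.of_forall fun t => ?_)).trans ?_
    · simp only [ContinuousLinearMap.lsmul_apply, norm_smul]
      rw [Real.norm_of_nonneg ((ρ k).nonneg_normed _)]
      exact mul_le_mul_of_nonneg_left (hld _ _) ((ρ k).nonneg_normed _)
    · rw [integral_mul_const, (ρ k).integral_normed, one_mul]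
  · have hli : LocallyIntegrable (fun x => lineDeriv ℝ ψ x v) μ := by
      refine (locallyIntegrable_const (K * ‖v‖ : ℝ)).mono (hldm v).aestronglyMeasurable ?_
      refine Eventually.of_forall fun x => (hld x v).trans (le_abs_self _)
    have hρ0 : Tendsto (fun k => (ρ k).rOut) atTop (𝓝 0) :=
      tendsto_const_nhds.div_atTop (tendsto_natCast_atTop_atTop.atTop_add tendsto_const_nhds)
    have := ContDiffBump.ae_convolution_tendsto_right_of_locallyIntegrable (K := 2) hρ0
      (Eventually.of_forall fun k => by simp only [ρ]; linarith) hli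
    filter_upwards [this, hψ.ae_differentiableAt (μ := μ)] with x hx hdx
    rw [← hdx.lineDeriv_eq_fderiv]
    exact hx.congr fun k => (hψ.fderiv_normed_convolution_apply hc _ _ _).symm

end Mollification

section TestFunctions

open scoped NNReal
open Filter Topology Set

/-- Bounded and Lipschitz on a set. -/
def BddLipOn {X : Type*} [NormedAddCommGroup X] (S : Set X) (f : X → ℝ) : Prop :=
  ∃ K : ℝ, 0 ≤ K ∧ (∀ x ∈ S, |f x| ≤ K) ∧ ∀ x ∈ S, ∀ y ∈ S, |f x - f y| ≤ K * ‖x - y‖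

namespace BddLipOn

variable {X : Type*} [NormedAddCommGroup X] {S : Set X} {f g : X → ℝ}

lemma const (c : ℝ) : BddLipOn S fun _ => c :=
  ⟨|c|, abs_nonneg c, fun _ _ => le_rfl, fun _ _ _ _ => by simp; positivity⟩

lemma congr (hf : BddLipOn S f) (h : ∀ x ∈ S, f x = g x) : BddLipOn S g := by
  obtain ⟨K, hK, h1, h2⟩ := hf
  refine ⟨K, hK, fun x hx => h x hx ▸ h1 x hx, fun x hx y hy => ?_⟩
  rw [← h x hx, ← h y hy]
  exact h2 x hx y hy

lemma add (hf : BddLipOn S f) (hg : BddLipOn S g) : BddLipOn S fun x => f x + g x := by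
  obtain ⟨K, hK, h1, h2⟩ := hf
  obtain ⟨L, hL, g1, g2⟩ := hg
  refine ⟨K + L, by positivity, fun x hx => (abs_add_le _ _).trans (add_le_add (h1 x hx) (g1 x hx)),
    fun x hx y hy => ?_⟩
  rw [add_sub_add_comm, add_mul]
  exact (abs_add_le _ _).trans (add_le_add (h2 x hx y hy) (g2 x hx y hy))

lemma mul (hf : BddLipOn S f) (hg : BddLipOn S g) : BddLipOn S fun x => f x * g x := by
  obtain ⟨K, hK, h1, h2⟩ := hf
  obtain ⟨L, hL, g1, g2⟩ := hg
  refine ⟨2 * K * L + K * L, by positivity, fun x hx => ?_, fun x hx y hy => ?_⟩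
  · rw [abs_mul]
    have := mul_le_mul (h1 x hx) (g1 x hx) (abs_nonneg _) hK
    nlinarith [mul_nonneg hK hL]
  · have e : f x * g x - f y * g y = f x * (g x - g y) + g y * (f x - f y) := by ring
    rw [e]
    refine (abs_add_le _ _).trans ?_
    rw [abs_mul, abs_mul]
    have a1 := mul_le_mul (h1 x hx) (g2 x hx y hy) (abs_nonneg _) hK
    have a2 := mul_le_mul (g1 y hy) (h2 x hx y hy) (abs_nonneg _) hL
    have : 0 ≤ K * L * ‖x - y‖ := by positivity
    nlinarith

lemma const_mul (c : ℝ) (hf : BddLipOn S f) : BddLipOn S fun x => c * f x := (const c).mul hf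

lemma neg (hf : BddLipOn S f) : BddLipOn S fun x => -f x :=
  (hf.const_mul (-1)).congr fun _ _ => by ring

lemma sub (hf : BddLipOn S f) (hg : BddLipOn S g) : BddLipOn S fun x => f x - g x :=
  (hf.add hg.neg).congr fun _ _ => by ring

lemma pow (hf : BddLipOn S f) (k : ℕ) : BddLipOn S fun x => f x ^ k := by
  induction k with
  | zero => simpa using const 1
  | succ k ih => simpa only [pow_succ] using ih.mul hf

lemma sum {ι : Type*} (s : Finset ι) {F : ι → X → ℝ} (h : ∀ i, BddLipOn S (F i)) :
    BddLipOn S fun x => ∑ i ∈ s, F i x := by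
  classical
  induction s using Finset.induction_on with
  | empty => simpa using const 0
  | insert a s ha ih => simpa only [Finset.sum_insert ha] using (h a).add ih

lemma inv {c : ℝ} (hc : 0 < c) (hf : BddLipOn S f) (h : ∀ x ∈ S, c ≤ f x) :
    BddLipOn S fun x => (f x)⁻¹ := by
  obtain ⟨K, hK, h1, h2⟩ := hf
  refine ⟨c⁻¹ + c⁻¹ * c⁻¹ * K, by positivity, fun x hx => ?_, fun x hx y hy => ?_⟩
  · have : 0 < f x := hc.trans_le (h x hx)
    rw [abs_of_pos (inv_pos.2 this)]
    have := inv_anti₀ hc (h x hx)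
    have : 0 ≤ c⁻¹ * c⁻¹ * K := by positivity
    linarith
  · have hx0 : 0 < f x := hc.trans_le (h x hx)
    have hy0 : 0 < f y := hc.trans_le (h y hy)
    have e : (f x)⁻¹ - (f y)⁻¹ = (f x)⁻¹ * (f y)⁻¹ * (f y - f x) := by field_simp
    rw [e, abs_mul, abs_of_pos (by positivity), abs_sub_comm]
    have i1 := inv_anti₀ hc (h x hx)
    have i2 := inv_anti₀ hc (h y hy)
    have i3 : (f x)⁻¹ * (f y)⁻¹ ≤ c⁻¹ * c⁻¹ := by gcongr
    have := mul_le_mul i3 (h2 x hx y hy) (abs_nonneg _) (by positivity)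
    have : 0 ≤ c⁻¹ * ‖x - y‖ := by positivity
    nlinarith

lemma sqrt {c : ℝ} (hc : 0 < c) (hf : BddLipOn S f) (h : ∀ x ∈ S, c ≤ f x) :
    BddLipOn S fun x => √(f x) := by
  obtain ⟨K, hK, h1, h2⟩ := hf
  have hsc : 0 < √c := Real.sqrt_pos.2 hc
  refine ⟨√K + (√c)⁻¹ * K, by positivity, fun x hx => ?_, fun x hx y hy => ?_⟩
  · rw [abs_of_nonneg (Real.sqrt_nonneg _)]
    have := Real.sqrt_le_sqrt ((le_abs_self _).trans (h1 x hx))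
    have : 0 ≤ (√c)⁻¹ * K := by positivity
    linarith
  · have hx0 : √c ≤ √(f x) := Real.sqrt_le_sqrt (h x hx)
    have hy0 : √c ≤ √(f y) := Real.sqrt_le_sqrt (h y hy)
    have ex := Real.sq_sqrt (hc.le.trans (h x hx))
    have ey := Real.sq_sqrt (hc.le.trans (h y hy))
    have e : (√(f x) - √(f y)) * (√(f x) + √(f y)) = f x - f y := by
      linear_combination ex - ey
    have h3 : |√(f x) - √(f y)| * √c ≤ K * ‖x - y‖ := by
      refine le_trans ?_ (h2 x hx y hy)
      rw [← e, abs_mul]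
      refine mul_le_mul_of_nonneg_left ?_ (abs_nonneg _)
      rw [abs_of_nonneg (by positivity)]
      linarith
    rw [← le_div_iff₀ hsc] at h3
    refine h3.trans ?_
    rw [add_mul, div_eq_inv_mul, ← mul_assoc]
    have : 0 ≤ √K * ‖x - y‖ := by positivity
    linarith

lemma exists_lipschitzOnWith (hf : BddLipOn S f) : ∃ K, LipschitzOnWith K f S := by
  obtain ⟨K, hK, -, h2⟩ := hf
  refine ⟨⟨K, hK⟩, LipschitzOnWith.of_dist_le_mul fun x hx y hy => ?_⟩
  rw [Real.dist_eq, dist_eq_norm]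
  exact h2 x hx y hy

lemma of_lipschitzOnWith {K : ℝ≥0} (hS : IsCompact S) (hf : LipschitzOnWith K f S) :
    BddLipOn S f := by
  obtain ⟨C, hC⟩ := hS.exists_bound_of_continuousOn hf.continuousOn
  refine ⟨K + |C|, by positivity, fun x hx => ?_, fun x hx y hy => ?_⟩
  · have := hC x hx
    rw [Real.norm_eq_abs] at this
    have h1 := le_abs_self C
    have h2 : (0:ℝ) ≤ K := K.2
    linarith
  · have := hf.dist_le_mul x hx y hy
    rw [Real.dist_eq, dist_eq_norm] at this
    have : 0 ≤ |C| * ‖x - y‖ := by positivity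
    nlinarith

lemma of_contDiff {X : Type*} [NormedAddCommGroup X] [NormedSpace ℝ X] {S : Set X} {f : X → ℝ}
    (hS : IsCompact S) (hf : ContDiff ℝ 1 f) : BddLipOn S f := by
  obtain ⟨K, hK⟩ := (hf.locallyLipschitz.locallyLipschitzOn (s := S)).exists_lipschitzOnWith_of_compact hS
  exact of_lipschitzOnWith hS hK

lemma continuousOn (hf : BddLipOn S f) : ContinuousOn f S := by
  obtain ⟨K, hK⟩ := hf.exists_lipschitzOnWith
  exact hK.continuousOn

end BddLipOn

/-- Euclidean space of dimension `n + 1`. -/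
abbrev Euc (n : ℕ) := EuclideanSpace ℝ (Fin (n + 1))

/-- The open annulus `1 < ‖x‖ < 2`. -/
def annulus (n : ℕ) : Set (Euc n) := {x | 1 < ‖x‖ ∧ ‖x‖ < 2}

/-- The closed annulus `1 ≤ ‖x‖ ≤ 2`. -/
def closedAnnulus (n : ℕ) : Set (Euc n) := {x | 1 ≤ ‖x‖ ∧ ‖x‖ ≤ 2}

/-- The partial derivative `∂f/∂xⁱ`. -/
noncomputable def partialD {n : ℕ} (i : Fin (n + 1)) (f : Euc n → ℝ) (x : Euc n) : ℝ :=
  fderiv ℝ f x (EuclideanSpace.single i 1)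

variable {n : ℕ}

lemma isOpen_annulus : IsOpen (annulus n) :=
  (isOpen_lt continuous_const continuous_norm).inter (isOpen_lt continuous_norm continuous_const)

lemma isCompact_closedAnnulus : IsCompact (closedAnnulus n) := by
  refine (isCompact_closedBall (0 : Euc n) 2).of_isClosed_subset ?_ fun x hx => ?_
  · exact (isClosed_le continuous_const continuous_norm).inter
      (isClosed_le continuous_norm continuous_const)
  · simpa using hx.2

lemma annulus_subset_closedAnnulus : annulus n ⊆ closedAnnulus n := fun _ hx => ⟨hx.1.le, hx.2.le⟩

lemma measurableSet_annulus : MeasurableSet (annulus n) := isOpen_annulus.measurableSet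

lemma volume_annulus_lt_top : volume (annulus n) < ⊤ :=
  (measure_mono annulus_subset_closedAnnulus).trans_lt isCompact_closedAnnulus.measure_lt_top

lemma abs_partialD_le {f : Euc n → ℝ} {K : ℝ≥0} (hf : LipschitzWith K f) (i : Fin (n + 1))
    (x : Euc n) : |partialD i f x| ≤ K := by
  have h := (fderiv ℝ f x).le_of_opNorm_le (norm_fderiv_le_of_lipschitz ℝ hf)
    (EuclideanSpace.single i (1 : ℝ))
  simpa [partialD] using h

lemma partialD_congr_of_mem_annulus {f g : Euc n → ℝ} (h : ∀ x ∈ annulus n, f x = g x)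
    (i : Fin (n + 1)) {x : Euc n} (hx : x ∈ annulus n) : partialD i f x = partialD i g x := by
  have : f =ᶠ[𝓝 x] g := by filter_upwards [isOpen_annulus.mem_nhds hx] with y hy using h y hy
  rw [partialD, this.fderiv_eq, partialD]

lemma measurable_partialD (f : Euc n → ℝ) (i : Fin (n + 1)) : Measurable (partialD i f) :=
  measurable_fderiv_apply_const ℝ f _

/-- A function Lipschitz on the closed annulus and vanishing on its boundary is controlled by the
distance to the boundary. -/
lemma abs_le_mul_gap {φ : Euc n → ℝ} {K : ℝ≥0} (hφ : LipschitzWith K φ)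
    (h1 : ∀ x, ‖x‖ = 1 → φ x = 0) (h2 : ∀ x, ‖x‖ = 2 → φ x = 0) {x : Euc n} (hx : x ∈ annulus n) :
    |φ x| ≤ K * min (‖x‖ - 1) (2 - ‖x‖) := by
  have hx0 : 0 < ‖x‖ := one_pos.trans hx.1
  have key : ∀ c : ℝ, 0 < c → (∀ y, ‖y‖ = c → φ y = 0) → |φ x| ≤ K * |‖x‖ - c| := by
    intro c hc h
    have hy : ‖(c / ‖x‖) • x‖ = c := by
      rw [norm_smul, Real.norm_of_nonneg (by positivity)]; field_simp
    have := hφ.dist_le_mul x ((c / ‖x‖) • x)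
    rw [h _ hy, dist_zero_right, Real.norm_eq_abs, dist_eq_norm] at this
    refine this.trans_eq ?_
    have e : x - (c / ‖x‖) • x = ((‖x‖ - c) / ‖x‖) • x := by
      rw [sub_div, div_self hx0.ne', sub_smul, one_smul]
    rw [e, norm_smul, Real.norm_eq_abs, abs_div, abs_of_pos hx0]
    field_simp
  rw [mul_min_of_nonneg _ _ K.coe_nonneg]
  refine le_min ?_ ?_
  · simpa [abs_of_pos (sub_pos.2 hx.1)] using key 1 one_pos h1
  · have := key 2 two_pos h2
    rwa [abs_sub_comm, abs_of_pos (sub_pos.2 hx.2)] at this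

/-- A distributional identity against smooth compactly supported functions extends to Lipschitz
functions vanishing on the boundary of the annulus. -/
theorem integral_eq_zero_of_lipschitz_test {V : Euc n → Fin (n + 1) → ℝ}
    (hV : ∀ i, IntegrableOn (fun x => V x i) (annulus n))
    (h : ∀ φ : Euc n → ℝ, ContDiff ℝ (⊤ : ℕ∞) φ → HasCompactSupport φ → tsupport φ ⊆ annulus n →
      ∫ x in annulus n, ∑ i, V x i * partialD i φ x = 0)
    {φ : Euc n → ℝ} (hφ : BddLipOn (closedAnnulus n) φ)
    (h1 : ∀ x, ‖x‖ = 1 → φ x = 0) (h2 : ∀ x, ‖x‖ = 2 → φ x = 0) :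
    ∫ x in annulus n, ∑ i, V x i * partialD i φ x = 0 := by
  have hdom : ∀ (C : ℝ) (u : ℕ → Euc n → ℝ) (w : Euc n → ℝ),
      (∀ k i x, |partialD i (u k) x| ≤ C) →
      (∀ i, ∀ᵐ x ∂volume.restrict (annulus n),
        Tendsto (fun k => partialD i (u k) x) atTop (𝓝 (partialD i w x))) →
      Tendsto (fun k => ∫ x in annulus n, ∑ i, V x i * partialD i (u k) x) atTop
        (𝓝 (∫ x in annulus n, ∑ i, V x i * partialD i w x)) := by
    intro C u w hb hl
    refine tendsto_integral_of_dominated_convergence (fun x => ∑ i, |V x i| * C) (fun k => ?_) ?_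
      (fun k => Eventually.of_forall fun x => ?_) ?_
    · exact Finset.aestronglyMeasurable_fun_sum _ fun i _ =>
        (hV i).aestronglyMeasurable.mul (measurable_partialD _ i).aestronglyMeasurable
    · exact integrable_finsetSum _ fun i _ => (hV i).abs.mul_const C
    · refine (norm_sum_le _ _).trans (Finset.sum_le_sum fun i _ => ?_)
      rw [norm_mul]
      exact mul_le_mul_of_nonneg_left (hb k i x) (norm_nonneg _)
    · filter_upwards [ae_all_iff.2 hl] with x hx
      exact tendsto_finsetSum _ fun i _ => (hx i).const_mul _
  have hcs : ∀ (C : ℝ≥0) (ψ : Euc n → ℝ), LipschitzWith C ψ → HasCompactSupport ψ →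
      tsupport ψ ⊆ annulus n → ∫ x in annulus n, ∑ i, V x i * partialD i ψ x = 0 := by
    intro C ψ hψ hc hs
    obtain ⟨u, hu1, hu2, hu3, hu4, hu5⟩ :=
      hψ.exists_smooth_approx (μ := volume) hc isOpen_annulus hs
    have := hdom C u ψ (fun k i x => by simpa [partialD] using hu4 k x (EuclideanSpace.single i 1))
      (fun i => ae_restrict_of_ae (hu5 _))
    refine tendsto_nhds_unique this ?_
    simp_rw [fun k => h (u k) (hu1 k) (hu2 k) (hu3 k)]
    exact tendsto_const_nhds
  obtain ⟨K, hK⟩ := hφ.exists_lipschitzOnWith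
  obtain ⟨φ', hφ', hφφ'⟩ := hK.extend_real
  have hgap := fun x (hx : x ∈ annulus n) => abs_le_mul_gap hφ'
    (fun x hx => (hφφ' ⟨hx.ge, by linarith⟩).symm.trans (h1 x hx))
    (fun x hx => (hφφ' ⟨by linarith, hx.le⟩).symm.trans (h2 x hx)) hx
  have hcongr : ∫ x in annulus n, ∑ i, V x i * partialD i φ x =
      ∫ x in annulus n, ∑ i, V x i * partialD i φ' x := by
    refine setIntegral_congr_fun measurableSet_annulus fun x hx => ?_
    refine Finset.sum_congr rfl fun i _ => ?_
    rw [partialD_congr_of_mem_annulus (fun y hy => hφφ' (annulus_subset_closedAnnulus hy)) i hx]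
  rw [hcongr]
  set e : Euc n → ℝ := fun x => min (‖x‖ - 1) (2 - ‖x‖) with he
  have hel : LipschitzWith 1 e := by
    refine LipschitzWith.of_dist_le_mul fun x y => ?_
    rw [Real.dist_eq, NNReal.coe_one, one_mul, dist_eq_norm]
    have h1 := abs_norm_sub_norm_le x y
    refine (abs_min_sub_min_le_max _ _ _ _).trans (max_le ?_ ?_)
    · rwa [sub_sub_sub_cancel_right]
    · rwa [sub_sub_sub_cancel_left, abs_sub_comm]
  let b : ℕ → Euc n → ℝ := fun k x => max 0 (2 * K * (e x - 1 / (k + 1)))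
  have hbl : ∀ k, LipschitzWith (2 * K) (b k) := by
    intro k
    refine LipschitzWith.const_max (LipschitzWith.of_dist_le_mul fun x y => ?_) 0
    have := hel.dist_le_mul x y
    rw [Real.dist_eq] at this ⊢
    rw [← mul_sub, sub_sub_sub_cancel_right, abs_mul, abs_of_nonneg (by positivity)]
    push_cast at this ⊢
    rw [one_mul] at this
    gcongr
  let u : ℕ → Euc n → ℝ := fun k x => max (-b k x) (min (φ' x) (b k x))
  have hul : ∀ k, LipschitzWith (2 * K) (u k) := by
    intro k
    have hK2 : K ≤ 2 * K := by
      rw [two_mul]; exact le_self_add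
    have := (hbl k).neg.max (hφ'.min (hbl k))
    rwa [max_eq_right hK2, max_self] at this
  have hus : ∀ k, tsupport (u k) ⊆ {x | 1 / ((k : ℝ) + 1) ≤ e x} := by
    intro k
    refine closure_minimal (fun x hx => ?_) (isClosed_le continuous_const hel.continuous)
    by_contra hlt
    simp only [mem_ofPred_eq, not_le] at hlt
    have hb0 : b k x = 0 := by
      refine max_eq_left ?_
      have : (0:ℝ) ≤ 2 * K := by positivity
      nlinarith
    refine hx ?_
    simp only [u, hb0, neg_zero]
    exact max_eq_left (min_le_right _ _)
  have hsub : ∀ k : ℕ, {x : Euc n | 1 / ((k : ℝ) + 1) ≤ e x} ⊆ annulus n := by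
    intro k x hx
    have hp : (0:ℝ) < 1 / ((k : ℝ) + 1) := by positivity
    have h3 := hp.trans_le hx
    rw [he, lt_min_iff] at h3
    exact ⟨by linarith [h3.1], by linarith [h3.2]⟩
  have hu0 : ∀ k, ∫ x in annulus n, ∑ i, V x i * partialD i (u k) x = 0 := fun k =>
    hcs _ _ (hul k) (isCompact_closedAnnulus.of_isClosed_subset (isClosed_tsupport _)
      (((hus k).trans (hsub k)).trans annulus_subset_closedAnnulus)) ((hus k).trans (hsub k))
  refine tendsto_nhds_unique (hdom (2 * K : ℝ≥0) u φ' (fun k i x => abs_partialD_le (hul k) i x)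
    fun i => ?_) (by simp_rw [hu0]; exact tendsto_const_nhds)
  refine (ae_restrict_iff' measurableSet_annulus).2 (Eventually.of_forall fun x hx => ?_)
  have hex : 0 < e x := lt_min (sub_pos.2 hx.1) (sub_pos.2 hx.2)
  have hsmall : ∀ᶠ k : ℕ in atTop, 1 / ((k : ℝ) + 1) < e x / 2 :=
    (tendsto_one_div_add_atTop_nhds_zero_nat (𝕜 := ℝ)).eventually_lt_const (by positivity)
  refine tendsto_const_nhds.congr' ?_
  filter_upwards [hsmall] with k hk
  have hev : φ' =ᶠ[𝓝 x] u k := by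
    have : ∀ᶠ y in 𝓝 x, 1 / ((k : ℝ) + 1) < e y / 2 :=
      (hel.continuous.div_const 2).continuousAt.eventually_const_lt hk
    filter_upwards [this, isOpen_annulus.mem_nhds hx] with y hy hyΩ
    have hg := hgap y hyΩ
    have hby : |φ' y| ≤ b k y := by
      refine le_max_of_le_right (hg.trans ?_)
      have hK0 : (0:ℝ) ≤ K := K.2
      change (K:ℝ) * e y ≤ _
      nlinarith
    rw [abs_le] at hby
    simp only [u]
    rw [min_eq_left hby.2, max_eq_right hby.1]
  rw [partialD, hev.fderiv_eq, partialD]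

end TestFunctions

section GraphMetric

open Matrix Finset

lemma isHermitian_transpose_mul_self_real {ι κ : Type*} [Fintype κ] (D : Matrix κ ι ℝ) :
    (Dᵀ * D).IsHermitian := by
  simpa using isHermitian_conjTranspose_mul_self D

/-- The metric `1 + DᵀD` of the graph of a map with Jacobian matrix `D`. -/
def graphMetric {ι κ : Type*} [Fintype κ] [DecidableEq ι] (D : Matrix κ ι ℝ) : Matrix ι ι ℝ := 1 + Dᵀ * D

lemma transpose_graphMetric {ι κ : Type*} [Fintype κ] [DecidableEq ι] (D : Matrix κ ι ℝ) : (graphMetric D)ᵀ = graphMetric D := by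
  simp [graphMetric, transpose_mul]

variable {ι κ : Type*} [Fintype ι] [Fintype κ] [DecidableEq ι]

/-- The area density of the graph of a map with Jacobian matrix `D`. -/
noncomputable def area (D : Matrix κ ι ℝ) : ℝ := √(graphMetric D).det

/-- The coefficients `√g g^{ij}` of the minimal surface system. -/
noncomputable def coef (D : Matrix κ ι ℝ) : Matrix ι ι ℝ := area D • (graphMetric D)⁻¹

lemma det_graphMetric_eq_prod (D : Matrix κ ι ℝ) :
    (graphMetric D).det = ∏ i, (1 + (isHermitian_transpose_mul_self_real D).eigenvalues i) := by
  have hS := isHermitian_transpose_mul_self_real D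
  have h := congrArg (Polynomial.eval (-1)) hS.charpoly_eq
  rw [Matrix.eval_charpoly, Polynomial.eval_prod] at h
  have h2 : graphMetric D = -(scalar ι (-1) - Dᵀ * D) := by
    rw [graphMetric, neg_sub, sub_eq_add_neg, add_comm]
    simp
  rw [h2, det_neg, h, ← Finset.card_univ, ← Finset.prod_const, ← Finset.prod_mul_distrib]
  refine Finset.prod_congr rfl fun i _ => ?_
  simp
  ring

lemma eigenvalues_transpose_mul_self_nonneg (D : Matrix κ ι ℝ) (i : ι) :
    0 ≤ (isHermitian_transpose_mul_self_real D).eigenvalues i := by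
  have := (posSemidef_conjTranspose_mul_self D).eigenvalues_nonneg i
  simpa using this

lemma one_le_det_graphMetric (D : Matrix κ ι ℝ) : 1 ≤ (graphMetric D).det := by
  rw [det_graphMetric_eq_prod]
  calc (1 : ℝ) = ∏ _i : ι, 1 := by simp
    _ ≤ _ := prod_le_prod (fun _ _ => zero_le_one) fun i _ => by
      linarith [eigenvalues_transpose_mul_self_nonneg D i]

lemma one_le_area (D : Matrix κ ι ℝ) : 1 ≤ area D :=
  Real.one_le_sqrt.2 (one_le_det_graphMetric D)

lemma isUnit_det_graphMetric (D : Matrix κ ι ℝ) : IsUnit (graphMetric D).det :=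
  isUnit_iff_ne_zero.2 (by linarith [one_le_det_graphMetric D])

lemma trace_coef_mul_graphMetric (D : Matrix κ ι ℝ) :
    (coef D * graphMetric D).trace = Fintype.card ι * area D := by
  rw [coef, smul_mul, nonsing_inv_mul _ (isUnit_det_graphMetric D)]
  simp [mul_comm]

/-- The decomposition `w = g u = u + Dᵀ(Du)`. -/
lemma dotProduct_inv_graphMetric_mulVec (D : Matrix κ ι ℝ) (a v : ι → ℝ) (b : κ → ℝ) :
    (a + Dᵀ *ᵥ b) ⬝ᵥ ((graphMetric D)⁻¹ *ᵥ v) =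
      a ⬝ᵥ ((graphMetric D)⁻¹ *ᵥ v) + b ⬝ᵥ (D *ᵥ ((graphMetric D)⁻¹ *ᵥ v)) := by
  rw [add_dotProduct, mulVec_transpose, ← dotProduct_mulVec]

lemma dotProduct_self_add_inv_graphMetric (D : Matrix κ ι ℝ) (v : ι → ℝ) :
    v ⬝ᵥ ((graphMetric D)⁻¹ *ᵥ v) =
      ((graphMetric D)⁻¹ *ᵥ v) ⬝ᵥ ((graphMetric D)⁻¹ *ᵥ v) +
        (D *ᵥ ((graphMetric D)⁻¹ *ᵥ v)) ⬝ᵥ (D *ᵥ ((graphMetric D)⁻¹ *ᵥ v)) := by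
  rw [← dotProduct_inv_graphMetric_mulVec]
  congr 1
  set u := (graphMetric D)⁻¹ *ᵥ v with hu
  have : v = graphMetric D *ᵥ u := by
    rw [hu, mulVec_mulVec, mul_nonsing_inv _ (isUnit_det_graphMetric D), one_mulVec]
  rw [this, graphMetric, add_mulVec, one_mulVec, ← mulVec_mulVec]

lemma dotProduct_inv_graphMetric_nonneg (D : Matrix κ ι ℝ) (v : ι → ℝ) :
    0 ≤ v ⬝ᵥ ((graphMetric D)⁻¹ *ᵥ v) := by
  rw [dotProduct_self_add_inv_graphMetric]
  exact add_nonneg (sum_nonneg fun _ _ => mul_self_nonneg _) (sum_nonneg fun _ _ => mul_self_nonneg _)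

lemma sq_dotProduct_inv_graphMetric_le (D : Matrix κ ι ℝ) (a v : ι → ℝ) (b : κ → ℝ) :
    ((a + Dᵀ *ᵥ b) ⬝ᵥ ((graphMetric D)⁻¹ *ᵥ v)) ^ 2 ≤
      (a ⬝ᵥ a + b ⬝ᵥ b) * (v ⬝ᵥ ((graphMetric D)⁻¹ *ᵥ v)) := by
  rw [dotProduct_inv_graphMetric_mulVec, dotProduct_self_add_inv_graphMetric]
  set u := (graphMetric D)⁻¹ *ᵥ v
  have h := sum_mul_sq_le_sq_mul_sq (univ : Finset (ι ⊕ κ)) (Sum.elim a b) (Sum.elim u (D *ᵥ u))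
  simp only [Fintype.sum_sum_type, Sum.elim_inl, Sum.elim_inr] at h
  simpa only [dotProduct, sq] using h

lemma dotProduct_inv_graphMetric_self_le (D : Matrix κ ι ℝ) (a : ι → ℝ) (b : κ → ℝ) :
    (a + Dᵀ *ᵥ b) ⬝ᵥ ((graphMetric D)⁻¹ *ᵥ (a + Dᵀ *ᵥ b)) ≤ a ⬝ᵥ a + b ⬝ᵥ b := by
  have h := sq_dotProduct_inv_graphMetric_le D a (a + Dᵀ *ᵥ b) b
  have h0 := dotProduct_inv_graphMetric_nonneg D (a + Dᵀ *ᵥ b)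
  rcases h0.eq_or_lt with h1 | h1
  · rw [← h1]
    exact add_nonneg (sum_nonneg fun _ _ => mul_self_nonneg _)
      (sum_nonneg fun _ _ => mul_self_nonneg _)
  · rw [sq] at h
    exact le_of_mul_le_mul_right h h1

lemma dotProduct_self_le_coef (D : Matrix κ ι ℝ) (v : ι → ℝ) :
    v ⬝ᵥ v ≤ (1 + ∑ a, ∑ i, D a i ^ 2) * (v ⬝ᵥ (coef D *ᵥ v)) := by
  have h := sq_dotProduct_inv_graphMetric_le D v v (D *ᵥ v)
  have hg : v + Dᵀ *ᵥ (D *ᵥ v) = graphMetric D *ᵥ v := by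
    rw [graphMetric, add_mulVec, one_mulVec, mulVec_mulVec]
  have h2 : (graphMetric D *ᵥ v) ⬝ᵥ ((graphMetric D)⁻¹ *ᵥ v) = v ⬝ᵥ v := by
    rw [dotProduct_mulVec, ← mulVec_transpose, mulVec_mulVec, transpose_nonsing_inv,
      transpose_graphMetric, nonsing_inv_mul _ (isUnit_det_graphMetric D), one_mulVec]
  rw [hg, h2] at h
  have h3 : (D *ᵥ v) ⬝ᵥ (D *ᵥ v) ≤ (∑ a, ∑ i, D a i ^ 2) * (v ⬝ᵥ v) := by
    simp only [dotProduct, mulVec]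
    rw [sum_mul]
    refine sum_le_sum fun a _ => ?_
    have := sum_mul_sq_le_sq_mul_sq univ (D a) v
    simpa only [sq] using this
  have h4 := dotProduct_inv_graphMetric_nonneg D v
  have h5 : v ⬝ᵥ ((graphMetric D)⁻¹ *ᵥ v) ≤ v ⬝ᵥ (coef D *ᵥ v) := by
    rw [coef, smul_mulVec, dotProduct_smul, smul_eq_mul]
    exact le_mul_of_one_le_left h4 (one_le_area D)
  have h6 : 0 ≤ ∑ a, ∑ i, D a i ^ 2 := sum_nonneg fun _ _ => sum_nonneg fun _ _ => sq_nonneg _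
  have h7 : (v ⬝ᵥ v) ^ 2 ≤ (v ⬝ᵥ v) * ((1 + ∑ a, ∑ i, D a i ^ 2) * (v ⬝ᵥ (coef D *ᵥ v))) := by
    refine h.trans ?_
    have h8 : v ⬝ᵥ v + (D *ᵥ v) ⬝ᵥ (D *ᵥ v) ≤ (1 + ∑ a, ∑ i, D a i ^ 2) * (v ⬝ᵥ v) := by
      linarith
    calc _ ≤ ((1 + ∑ a, ∑ i, D a i ^ 2) * (v ⬝ᵥ v)) * (v ⬝ᵥ (coef D *ᵥ v)) :=
          mul_le_mul h8 h5 h4 ((add_nonneg (sum_nonneg fun _ _ => mul_self_nonneg _)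
            (sum_nonneg fun _ _ => mul_self_nonneg _)).trans h8)
      _ = _ := by ring
  have h0 : 0 ≤ v ⬝ᵥ v := sum_nonneg fun _ _ => mul_self_nonneg _
  rcases h0.eq_or_lt with h1 | h1
  · rw [← h1]
    exact mul_nonneg (by linarith) (h4.trans h5)
  · rw [sq] at h7
    exact le_of_mul_le_mul_left h7 h1

lemma det_graphMetric_mul_dotProduct_inv (D : Matrix κ ι ℝ) (e : ι → ℝ) (he : e ⬝ᵥ e = 1) :
    (graphMetric D).det * (e ⬝ᵥ ((graphMetric D)⁻¹ *ᵥ e)) = (graphMetric (D * (1 - vecMulVec e e))).det := by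
  set P : Matrix ι ι ℝ := 1 - vecMulVec e e with hP
  have hPT : Pᵀ = P := by
    rw [hP, transpose_sub, transpose_vecMulVec, transpose_one]
  have hPP : P * P = P := by
    have : vecMulVec e e * vecMulVec e e = vecMulVec e e := by
      rw [vecMulVec_mul_vecMulVec, he, one_smul]
    rw [hP, sub_mul, mul_sub, mul_sub, this]
    simp
  have h1 : (graphMetric (D * P)).det = (1 + Dᵀ * D * P).det := by
    rw [graphMetric, transpose_mul, hPT, Matrix.mul_assoc, det_one_add_mul_comm, ← Matrix.mul_assoc,
      Matrix.mul_assoc, hPP]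
  have h2 : 1 + Dᵀ * D * P = graphMetric D * (1 + vecMulVec ((graphMetric D)⁻¹ *ᵥ e - e) e) := by
    rw [Matrix.mul_add, Matrix.mul_one, sub_vecMulVec, Matrix.mul_sub (graphMetric D),
      mul_vecMulVec, mulVec_mulVec, mul_nonsing_inv _ (isUnit_det_graphMetric D), one_mulVec, hP]
    simp only [graphMetric, Matrix.mul_sub, Matrix.add_mul, Matrix.one_mul, Matrix.mul_one]
    abel
  rw [h1, h2, det_mul, vecMulVec_eq Unit, det_one_add_replicateCol_mul_replicateRow,
    dotProduct_sub, he]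
  ring

lemma area_mul_sqrt_inv_graphMetric (D : Matrix κ ι ℝ) (e : ι → ℝ) (he : e ⬝ᵥ e = 1) :
    area D * √(e ⬝ᵥ ((graphMetric D)⁻¹ *ᵥ e)) = area (D * (1 - vecMulVec e e)) := by
  rw [area, ← Real.sqrt_mul (by linarith [one_le_det_graphMetric D]), det_graphMetric_mul_dotProduct_inv D e he,
    area]

lemma det_graphMetric_le_of_rank_le (T : Matrix κ ι ℝ) {r : ℕ} (hr : T.rank ≤ r) {c : ℝ}
    (hc : ∑ a, ∑ i, T a i ^ 2 ≤ c) : (graphMetric T).det ≤ (1 + c) ^ r := by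
  have hS := isHermitian_transpose_mul_self_real T
  have hnn := eigenvalues_transpose_mul_self_nonneg T
  have htr : ∑ i, hS.eigenvalues i ≤ c := by
    have h := hS.trace_eq_sum_eigenvalues
    simp only [RCLike.ofReal_real_eq_id, id] at h
    rw [← h]
    refine le_of_eq_of_le ?_ hc
    simp only [trace, Matrix.diag, mul_apply, transpose_apply]
    rw [sum_comm]
    simp only [sq]
  have hle : ∀ i, hS.eigenvalues i ≤ c := fun i =>
    (single_le_sum (fun i _ => hnn i) (mem_univ i)).trans htr
  have hc0 : 0 ≤ c := (sum_nonneg fun i _ => hnn i).trans htr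
  rw [det_graphMetric_eq_prod]
  have hcard : #{i | hS.eigenvalues i ≠ 0} ≤ r := by
    have h1 := hS.rank_eq_card_non_zero_eigs
    rw [rank_transpose_mul_self, Fintype.card_subtype] at h1
    rw [← h1]
    exact hr
  calc ∏ i, (1 + hS.eigenvalues i)
      ≤ ∏ i, (if hS.eigenvalues i ≠ 0 then 1 + c else 1) := by
        refine prod_le_prod (fun i _ => by linarith [hnn i]) fun i _ => ?_
        split_ifs with h
        · linarith [hle i]
        · rw [not_not.1 h, add_zero]
    _ = (1 + c) ^ #{i | hS.eigenvalues i ≠ 0} := by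
        rw [prod_ite, prod_const, prod_const_one, mul_one]
    _ ≤ (1 + c) ^ r := pow_le_pow_right₀ (by linarith) hcard

lemma continuous_graphMetric_det : Continuous fun D : Matrix κ ι ℝ => (graphMetric D).det := by
  unfold graphMetric
  fun_prop

lemma continuous_area : Continuous fun D : Matrix κ ι ℝ => area D :=
  continuous_graphMetric_det.sqrt

lemma continuous_coef (i j : ι) : Continuous fun D : Matrix κ ι ℝ => coef D i j := by
  have h : (fun D : Matrix κ ι ℝ => coef D i j) =
      fun D => area D * ((graphMetric D).det⁻¹ * (graphMetric D).adjugate i j) := by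
    ext D
    simp [coef, Matrix.inv_def, Ring.inverse_eq_inv']
  rw [h]
  refine continuous_area.mul ((continuous_graphMetric_det.inv₀ fun D => ?_).mul ?_)
  · linarith [one_le_det_graphMetric D]
  · have : Continuous fun D : Matrix κ ι ℝ => (graphMetric D).adjugate := by
      unfold graphMetric
      fun_prop
    exact this.matrix_elem i j

/-- The matrices all of whose entries are bounded by `K`. -/
def matrixBox (κ ι : Type*) (K : ℝ) : Set (κ → ι → ℝ) := {D | ∀ a i, |D a i| ≤ K}

lemma isCompact_matrixBox {κ ι : Type*} (K : ℝ) : IsCompact (matrixBox κ ι K) := by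
  have h : matrixBox κ ι K = Set.univ.pi fun _ => Set.univ.pi fun _ => Set.Icc (-K) K := by
    ext D
    simp only [matrixBox, abs_le, Set.mem_pi, Set.mem_univ, Set.mem_Icc, forall_const,
      Set.mem_ofPred_eq]
  rw [h]
  exact isCompact_univ_pi fun _ => isCompact_univ_pi fun _ => isCompact_Icc

lemma exists_bound_matrixBox {κ ι : Type*} {f : (κ → ι → ℝ) → ℝ} (hf : Continuous f) (K : ℝ) :
    ∃ C, 0 ≤ C ∧ ∀ D ∈ matrixBox κ ι K, |f D| ≤ C := by
  obtain ⟨C, hC⟩ := (isCompact_matrixBox K).exists_bound_of_continuousOn hf.continuousOn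
  exact ⟨max C 0, le_max_right _ _, fun D hD => (hC D hD).trans (le_max_left _ _)⟩

lemma exists_coef_bound (κ ι : Type*) [Fintype ι] [Fintype κ] [DecidableEq ι] (K : ℝ) :
    ∃ C, 0 ≤ C ∧ ∀ D ∈ matrixBox κ ι K, (∀ i j, |coef (of D) i j| ≤ C) ∧ area (of D) ≤ C := by
  have h1 : ∀ p : ι × ι, ∃ C, 0 ≤ C ∧ ∀ D ∈ matrixBox κ ι K, |coef (of D) p.1 p.2| ≤ C := fun p =>
    exists_bound_matrixBox (continuous_coef p.1 p.2) K
  choose C hC0 hC using h1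
  obtain ⟨C', hC'0, hC'⟩ := exists_bound_matrixBox (κ := κ) (ι := ι) continuous_area K
  refine ⟨C' + ∑ p, C p, add_nonneg hC'0 (sum_nonneg fun p _ => hC0 p), fun D hD =>
    ⟨fun i j => (hC (i, j) D hD).trans ?_, ((le_abs_self _).trans (hC' D hD)).trans ?_⟩⟩
  · have := single_le_sum (fun p _ => hC0 p) (mem_univ (i, j))
    linarith
  · linarith [sum_nonneg fun p (_ : p ∈ univ) => hC0 p]

lemma exists_area_le_add_sq (κ ι : Type*) [Fintype ι] [Fintype κ] [DecidableEq ι] (K : ℝ) :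
    ∃ C, 0 ≤ C ∧ ∀ T₁ ∈ matrixBox κ ι K, ∀ T₂ ∈ matrixBox κ ι K,
      area (of T₁) ≤ area (of T₂) + 1 + C * ∑ a, ∑ i, (T₁ a i - T₂ a i) ^ 2 := by
  obtain ⟨M, hM0, hM⟩ := exists_bound_matrixBox (κ := κ) (ι := ι) continuous_area K
  have hu := (isCompact_matrixBox (κ := κ) (ι := ι) K).uniformContinuousOn_of_continuous
    (f := fun D => area (of D)) continuous_area.continuousOn
  obtain ⟨δ, hδ, h⟩ := Metric.uniformContinuousOn_iff.1 hu 1 one_pos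
  refine ⟨M / δ ^ 2, by positivity, fun T₁ h1 T₂ h2 => ?_⟩
  have hS : 0 ≤ ∑ a, ∑ i, (T₁ a i - T₂ a i) ^ 2 := sum_nonneg fun _ _ => sum_nonneg fun _ _ =>
    sq_nonneg _
  by_cases hd : dist T₁ T₂ < δ
  · have := h T₁ h1 T₂ h2 hd
    rw [Real.dist_eq] at this
    have h3 : 0 ≤ M / δ ^ 2 * ∑ a, ∑ i, (T₁ a i - T₂ a i) ^ 2 := by positivity
    linarith [(abs_lt.1 this).2]
  · have h3 : δ ^ 2 ≤ ∑ a, ∑ i, (T₁ a i - T₂ a i) ^ 2 := by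
      by_contra! hlt
      apply hd
      refine (dist_pi_lt_iff hδ).2 fun a => (dist_pi_lt_iff hδ).2 fun i => ?_
      rw [Real.dist_eq]
      refine abs_lt_of_sq_lt_sq (lt_of_le_of_lt ?_ hlt) hδ.le
      exact (single_le_sum (f := fun i => (T₁ a i - T₂ a i) ^ 2) (fun _ _ => sq_nonneg _)
        (mem_univ i)).trans (single_le_sum (f := fun a => ∑ i, (T₁ a i - T₂ a i) ^ 2)
        (fun _ _ => sum_nonneg fun _ _ => sq_nonneg _) (mem_univ a))
    have h4 : M ≤ M / δ ^ 2 * ∑ a, ∑ i, (T₁ a i - T₂ a i) ^ 2 := by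
      rw [div_mul_eq_mul_div, le_div_iff₀ (by positivity)]
      exact mul_le_mul_of_nonneg_left h3 hM0
    have h5 := (le_abs_self _).trans (hM T₁ h1)
    have h6 := one_le_area (of T₂)
    change area (of T₁) ≤ M at h5
    linarith

end GraphMetric

section WeakForm

open scoped NNReal
open Filter Topology Set

variable {n : ℕ} {κ : Type*} [Fintype κ]

/-- `f` is differentiable at `x` with `i`-th partial derivative `d`. -/
def HasPartialAt (i : Fin (n + 1)) (f : Euc n → ℝ) (d : ℝ) (x : Euc n) : Prop :=
  ∃ L : Euc n →L[ℝ] ℝ, HasFDerivAt f L x ∧ L (EuclideanSpace.single i 1) = d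

namespace HasPartialAt

variable {i : Fin (n + 1)} {f g : Euc n → ℝ} {d e : ℝ} {x : Euc n}

lemma partialD_eq (h : HasPartialAt i f d x) : partialD i f x = d := by
  obtain ⟨L, hL, rfl⟩ := h
  rw [partialD, hL.fderiv]

lemma of_differentiableAt (h : DifferentiableAt ℝ f x) : HasPartialAt i f (partialD i f x) x :=
  ⟨_, h.hasFDerivAt, rfl⟩

lemma congr_value (h : HasPartialAt i f d x) (hde : d = e) : HasPartialAt i f e x := hde ▸ h

lemma const (c : ℝ) : HasPartialAt i (fun _ => c) 0 x := ⟨0, hasFDerivAt_const c x, rfl⟩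

lemma add (hf : HasPartialAt i f d x) (hg : HasPartialAt i g e x) :
    HasPartialAt i (fun y => f y + g y) (d + e) x := by
  obtain ⟨L, hL, rfl⟩ := hf
  obtain ⟨M, hM, rfl⟩ := hg
  exact ⟨_, hL.add hM, rfl⟩

lemma neg (hf : HasPartialAt i f d x) : HasPartialAt i (fun y => -f y) (-d) x := by
  obtain ⟨L, hL, rfl⟩ := hf
  exact ⟨_, hL.neg, rfl⟩

lemma sub (hf : HasPartialAt i f d x) (hg : HasPartialAt i g e x) :
    HasPartialAt i (fun y => f y - g y) (d - e) x := by
  obtain ⟨L, hL, rfl⟩ := hf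
  obtain ⟨M, hM, rfl⟩ := hg
  exact ⟨_, hL.sub hM, rfl⟩

lemma mul (hf : HasPartialAt i f d x) (hg : HasPartialAt i g e x) :
    HasPartialAt i (fun y => f y * g y) (d * g x + f x * e) x := by
  obtain ⟨L, hL, rfl⟩ := hf
  obtain ⟨M, hM, rfl⟩ := hg
  refine ⟨_, hL.mul hM, ?_⟩
  simp
  ring

lemma comp {φ : ℝ → ℝ} {c : ℝ} (hφ : HasDerivAt φ c (f x)) (hf : HasPartialAt i f d x) :
    HasPartialAt i (fun y => φ (f y)) (c * d) x := by
  obtain ⟨L, hL, rfl⟩ := hf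
  exact ⟨_, hφ.comp_hasFDerivAt x hL, rfl⟩

lemma pow (hf : HasPartialAt i f d x) (k : ℕ) :
    HasPartialAt i (fun y => f y ^ k) (k * f x ^ (k - 1) * d) x :=
  comp (hasDerivAt_pow k (f x)) hf

lemma inv (hf : HasPartialAt i f d x) (h : f x ≠ 0) :
    HasPartialAt i (fun y => (f y)⁻¹) (-(f x ^ 2)⁻¹ * d) x :=
  comp (hasDerivAt_inv h) hf

lemma sqrt (hf : HasPartialAt i f d x) (h : f x ≠ 0) :
    HasPartialAt i (fun y => √(f y)) (1 / (2 * √(f x)) * d) x :=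
  comp (Real.hasDerivAt_sqrt h) hf

lemma sum {ι : Type*} (s : Finset ι) {f : ι → Euc n → ℝ} {d : ι → ℝ}
    (h : ∀ k ∈ s, HasPartialAt i (f k) (d k) x) :
    HasPartialAt i (fun y => ∑ k ∈ s, f k y) (∑ k ∈ s, d k) x := by
  classical
  induction s using Finset.induction_on with
  | empty => simpa using const 0
  | insert a s ha ih =>
    simp only [Finset.sum_insert ha]
    exact (h a (Finset.mem_insert_self _ _)).add
      (ih fun k hk => h k (Finset.mem_insert_of_mem hk))

lemma coord (j : Fin (n + 1)) : HasPartialAt i (fun y : Euc n => y j) (if j = i then 1 else 0) x := by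
  refine ⟨EuclideanSpace.proj j, (EuclideanSpace.proj (𝕜 := ℝ) j).hasFDerivAt, ?_⟩
  simp

end HasPartialAt

/-- Admissible test functions on the annulus. -/
structure IsTest (φ : Euc n → ℝ) : Prop where
  bddLip : BddLipOn (closedAnnulus n) φ
  eq_zero : ∀ x, ‖x‖ = 1 ∨ ‖x‖ = 2 → φ x = 0

lemma BddLipOn.exists_bound_partialD {φ : Euc n → ℝ} (h : BddLipOn (closedAnnulus n) φ) :
    ∃ K : ℝ, 0 ≤ K ∧ ∀ x ∈ annulus n, ∀ i, |partialD i φ x| ≤ K := by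
  obtain ⟨K, hK⟩ := h.exists_lipschitzOnWith
  obtain ⟨g, hg, hgφ⟩ := hK.extend_real
  refine ⟨K, K.coe_nonneg, fun x hx i => ?_⟩
  rw [partialD_congr_of_mem_annulus (fun y hy => hgφ (annulus_subset_closedAnnulus hy)) i hx]
  exact abs_partialD_le hg i x

lemma IsTest.mul {φ ψ : Euc n → ℝ} (h : IsTest φ) (hψ : BddLipOn (closedAnnulus n) ψ) :
    IsTest fun x => φ x * ψ x :=
  ⟨h.bddLip.mul hψ, fun x hx => by rw [h.eq_zero x hx, zero_mul]⟩

/-- The Jacobian matrix of a tuple of functions. -/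
noncomputable def jac (F : κ → Euc n → ℝ) (x : Euc n) : Matrix κ (Fin (n + 1)) ℝ :=
  Matrix.of fun a i => partialD i (F a) x

/-- Globally Lipschitz tuples weakly satisfying the minimal surface system on the annulus. -/
structure IsMinimal (F : κ → Euc n → ℝ) : Prop where
  lipschitz : ∃ K : ℝ≥0, ∀ a, LipschitzWith K (F a)
  base : ∀ φ : Euc n → ℝ, ContDiff ℝ (⊤ : ℕ∞) φ → HasCompactSupport φ → tsupport φ ⊆ annulus n →
    ∀ j, ∫ x in annulus n, ∑ i, coef (jac F x) i j * partialD i φ x = 0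
  fiber : ∀ φ : Euc n → ℝ, ContDiff ℝ (⊤ : ℕ∞) φ → HasCompactSupport φ → tsupport φ ⊆ annulus n →
    ∀ a, ∫ x in annulus n, ∑ i, (∑ j, coef (jac F x) i j * partialD j (F a) x) *
      partialD i φ x = 0

lemma measurable_jac {κ : Type*} (F : κ → Euc n → ℝ) :
    Measurable fun x => (fun a i => partialD i (F a) x : κ → Fin (n + 1) → ℝ) :=
  measurable_pi_lambda _ fun a => measurable_pi_lambda _ fun i => measurable_partialD (F a) i

lemma Continuous.measurable_comp_jac {f : Matrix κ (Fin (n + 1)) ℝ → ℝ} (hf : Continuous f)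
    (F : κ → Euc n → ℝ) : Measurable fun x => f (jac F x) := by
  have h : Continuous fun D : κ → Fin (n + 1) → ℝ => f (Matrix.of D) := hf
  exact h.measurable.comp (measurable_jac F)

lemma measurable_coef_jac (F : κ → Euc n → ℝ) (i j : Fin (n + 1)) :
    Measurable fun x => coef (jac F x) i j :=
  (continuous_coef i j).measurable_comp_jac F

lemma measurable_area_jac (F : κ → Euc n → ℝ) : Measurable fun x => area (jac F x) :=
  continuous_area.measurable_comp_jac F

lemma integrableOn_annulus_of_bound {f : Euc n → ℝ}
    (hf : AEStronglyMeasurable f (volume.restrict (annulus n))) {C : ℝ}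
    (h : ∀ x ∈ annulus n, |f x| ≤ C) : IntegrableOn f (annulus n) :=
  haveI : IsFiniteMeasure (volume.restrict (annulus n)) := ⟨by simpa using volume_annulus_lt_top⟩
  Integrable.of_bound hf C ((ae_restrict_iff' measurableSet_annulus).2 (ae_of_all _ h))

namespace IsMinimal

variable {F : κ → Euc n → ℝ}

lemma exists_bounds (hF : IsMinimal F) : ∃ C : ℝ, 0 ≤ C ∧ (∀ a x y, |F a x - F a y| ≤ C * ‖x - y‖) ∧
    ∀ x, (∀ a i, |partialD i (F a) x| ≤ C) ∧ (∀ i j, |coef (jac F x) i j| ≤ C) ∧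
      area (jac F x) ≤ C := by
  obtain ⟨K, hK⟩ := hF.lipschitz
  obtain ⟨C, hC0, hC⟩ := exists_coef_bound κ (Fin (n + 1)) (K : ℝ)
  have hle : ∀ a x i, |partialD i (F a) x| ≤ K := fun a x i => abs_partialD_le (hK a) i x
  refine ⟨C + K, by positivity, fun a x y => ?_, fun x => ⟨fun a i => (hle a x i).trans (by linarith),
    fun i j => ?_, ?_⟩⟩
  · have := (hK a).dist_le_mul x y
    rw [Real.dist_eq, dist_eq_norm] at this
    nlinarith [norm_nonneg (x - y)]
  · have := (hC (fun a i => partialD i (F a) x) fun a i => hle a x i).1 i j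
    exact this.trans (by linarith [K.coe_nonneg])
  · have := (hC (fun a i => partialD i (F a) x) fun a i => hle a x i).2
    exact this.trans (by linarith [K.coe_nonneg])

lemma bddLipOn (hF : IsMinimal F) (a : κ) : BddLipOn (closedAnnulus n) (F a) := by
  obtain ⟨K, hK⟩ := hF.lipschitz
  exact .of_lipschitzOnWith isCompact_closedAnnulus ((hK a).lipschitzOnWith)

lemma ae_differentiableAt (hF : IsMinimal F) : ∀ᵐ x : Euc n, ∀ a, DifferentiableAt ℝ (F a) x := by
  obtain ⟨K, hK⟩ := hF.lipschitz
  exact ae_all_iff.2 fun a => (hK a).ae_differentiableAt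

lemma integrableOn_coef (hF : IsMinimal F) (i j : Fin (n + 1)) :
    IntegrableOn (fun x => coef (jac F x) i j) (annulus n) := by
  obtain ⟨C, hC0, -, hC⟩ := hF.exists_bounds
  exact integrableOn_annulus_of_bound (measurable_coef_jac F i j).aestronglyMeasurable fun x _ =>
    (hC x).2.1 i j

lemma integrableOn_coef_mul (hF : IsMinimal F) (i j : Fin (n + 1)) (a : κ) :
    IntegrableOn (fun x => coef (jac F x) i j * partialD j (F a) x) (annulus n) := by
  obtain ⟨C, hC0, -, hC⟩ := hF.exists_bounds
  refine integrableOn_annulus_of_bound ((measurable_coef_jac F i j).mul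
    (measurable_partialD _ _)).aestronglyMeasurable (C := C * C) fun x _ => ?_
  rw [abs_mul]
  exact mul_le_mul ((hC x).2.1 i j) ((hC x).1 a j) (abs_nonneg _) hC0

lemma integrableOn_mul_partialD {V φ : Euc n → ℝ} (hV : IntegrableOn V (annulus n))
    (hφ : BddLipOn (closedAnnulus n) φ) (i : Fin (n + 1)) :
    IntegrableOn (fun x => V x * partialD i φ x) (annulus n) := by
  obtain ⟨K, hK0, hK⟩ := hφ.exists_bound_partialD
  exact hV.mul_bdd (c := K) (measurable_partialD φ i).aestronglyMeasurable
    ((ae_restrict_iff' measurableSet_annulus).2 (ae_of_all _ fun x hx => hK x hx i))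

/-- The first variation formula, tested with a Lipschitz field of `ℝⁿ⁺¹ × ℝᵏ`. -/
theorem stationary (hF : IsMinimal F) {Φ : Fin (n + 1) → Euc n → ℝ} {Ψ : κ → Euc n → ℝ}
    (hΦ : ∀ j, IsTest (Φ j)) (hΨ : ∀ a, IsTest (Ψ a)) :
    IntegrableOn (fun x => ∑ i, ∑ j, coef (jac F x) i j *
      (partialD i (Φ j) x + ∑ a, partialD j (F a) x * partialD i (Ψ a) x)) (annulus n) ∧
    ∫ x in annulus n, ∑ i, ∑ j, coef (jac F x) i j *
      (partialD i (Φ j) x + ∑ a, partialD j (F a) x * partialD i (Ψ a) x) = 0 := by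
  have hV : ∀ i a, IntegrableOn (fun x => ∑ j, coef (jac F x) i j * partialD j (F a) x) (annulus n) :=
    fun i a => integrable_finsetSum _ fun j _ => hF.integrableOn_coef_mul i j a
  have i1 : ∀ j, IntegrableOn (fun x => ∑ i, coef (jac F x) i j * partialD i (Φ j) x) (annulus n) :=
    fun j => integrable_finsetSum _ fun i _ =>
      integrableOn_mul_partialD (hF.integrableOn_coef i j) (hΦ j).bddLip i
  have i2 : ∀ a, IntegrableOn (fun x => ∑ i, (∑ j, coef (jac F x) i j * partialD j (F a) x) *
      partialD i (Ψ a) x) (annulus n) := fun a => integrable_finsetSum _ fun i _ =>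
    integrableOn_mul_partialD (hV i a) (hΨ a).bddLip i
  have e1 : ∀ j, ∫ x in annulus n, ∑ i, coef (jac F x) i j * partialD i (Φ j) x = 0 := fun j =>
    integral_eq_zero_of_lipschitz_test (V := fun x i => coef (jac F x) i j)
      (fun i => hF.integrableOn_coef i j) (fun φ h1 h2 h3 => hF.base φ h1 h2 h3 j) (hΦ j).bddLip
      (fun x hx => (hΦ j).eq_zero x (.inl hx)) (fun x hx => (hΦ j).eq_zero x (.inr hx))
  have e2 : ∀ a, ∫ x in annulus n, ∑ i, (∑ j, coef (jac F x) i j * partialD j (F a) x) *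
      partialD i (Ψ a) x = 0 := fun a =>
    integral_eq_zero_of_lipschitz_test
      (V := fun x i => ∑ j, coef (jac F x) i j * partialD j (F a) x)
      (fun i => hV i a) (fun φ h1 h2 h3 => hF.fiber φ h1 h2 h3 a) (hΨ a).bddLip
      (fun x hx => (hΨ a).eq_zero x (.inl hx)) (fun x hx => (hΨ a).eq_zero x (.inr hx))
  have hsplit : (fun x => ∑ i, ∑ j, coef (jac F x) i j *
      (partialD i (Φ j) x + ∑ a, partialD j (F a) x * partialD i (Ψ a) x)) = fun x =>
      ∑ j, ∑ i, coef (jac F x) i j * partialD i (Φ j) x +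
        ∑ a, ∑ i, (∑ j, coef (jac F x) i j * partialD j (F a) x) * partialD i (Ψ a) x := by
    ext x
    simp only [mul_add, Finset.sum_add_distrib, Finset.mul_sum, Finset.sum_mul]
    congr 1
    · exact Finset.sum_comm
    · simp only [← mul_assoc]
      refine (Finset.sum_congr rfl fun i _ => Finset.sum_comm).trans ?_
      exact Finset.sum_comm
  rw [hsplit]
  refine ⟨(integrable_finsetSum _ fun j _ => i1 j).add (integrable_finsetSum _ fun a _ => i2 a), ?_⟩
  rw [integral_add (integrable_finsetSum _ fun j _ => i1 j) (integrable_finsetSum _ fun a _ => i2 a),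
    integral_finsetSum _ fun j _ => i1 j, integral_finsetSum _ fun a _ => i2 a]
  simp [e1, e2]

end IsMinimal

end WeakForm

section BoundaryLayer

open scoped NNReal
open Filter Topology Set

variable {n : ℕ}

/-- The squared norm in coordinates. -/
def normSq (x : Euc n) : ℝ := ∑ i, x i ^ 2

lemma normSq_eq (x : Euc n) : normSq x = ‖x‖ ^ 2 := (EuclideanSpace.real_norm_sq_eq x).symm

/-- A defining function of the annulus. -/
def defFun (x : Euc n) : ℝ := (normSq x - 1) * (4 - normSq x)

/-- The partial derivatives of `defFun`. -/
def defGrad (i : Fin (n + 1)) (x : Euc n) : ℝ := 2 * x i * (5 - 2 * normSq x)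

lemma contDiff_normSq : ContDiff ℝ 1 (normSq : Euc n → ℝ) := by
  unfold normSq
  fun_prop

lemma contDiff_defFun : ContDiff ℝ 1 (defFun : Euc n → ℝ) := by
  unfold defFun
  have := contDiff_normSq (n := n)
  fun_prop

lemma contDiff_defGrad (i : Fin (n + 1)) : ContDiff ℝ 1 (defGrad i : Euc n → ℝ) := by
  unfold defGrad
  have := contDiff_normSq (n := n)
  fun_prop

lemma hasPartialAt_normSq (i : Fin (n + 1)) (x : Euc n) : HasPartialAt i normSq (2 * x i) x := by
  have h : HasPartialAt i (fun y : Euc n => ∑ j, y j ^ 2) _ x := HasPartialAt.sum Finset.univ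
    fun j _ => (HasPartialAt.coord j).pow 2
  refine (show HasPartialAt i normSq _ x from h).congr_value ?_
  simp

lemma hasPartialAt_defFun (i : Fin (n + 1)) (x : Euc n) :
    HasPartialAt i defFun (defGrad i x) x := by
  have h := ((hasPartialAt_normSq i x).sub (.const 1)).mul
    ((HasPartialAt.const 4).sub (hasPartialAt_normSq i x))
  refine (show HasPartialAt i defFun _ x from h).congr_value ?_
  unfold defGrad
  ring

lemma defFun_eq (x : Euc n) : defFun x = (‖x‖ - 1) * (2 - ‖x‖) * ((‖x‖ + 1) * (2 + ‖x‖)) := by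
  rw [defFun, normSq_eq]
  ring

lemma defFun_pos {x : Euc n} (hx : x ∈ annulus n) : 0 < defFun x := by
  rw [defFun_eq]
  have h1 := sub_pos.2 hx.1
  have h2 := sub_pos.2 hx.2
  have h3 := norm_nonneg x
  positivity

lemma defFun_nonneg {x : Euc n} (hx : x ∈ closedAnnulus n) : 0 ≤ defFun x := by
  rw [defFun_eq]
  have h1 := sub_nonneg.2 hx.1
  have h2 := sub_nonneg.2 hx.2
  have h3 := norm_nonneg x
  positivity

lemma defFun_eq_zero {x : Euc n} (hx : ‖x‖ = 1 ∨ ‖x‖ = 2) : defFun x = 0 := by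
  rw [defFun_eq]
  rcases hx with h | h <;> simp [h]

lemma min_le_defFun {x : Euc n} (hx : x ∈ annulus n) : min (‖x‖ - 1) (2 - ‖x‖) ≤ defFun x := by
  rw [defFun_eq]
  obtain ⟨h1, h2⟩ := hx
  have h3 : 6 ≤ (‖x‖ + 1) * (2 + ‖x‖) := by nlinarith
  rcases le_total ‖x‖ (3 / 2) with h | h
  · refine (min_le_left _ _).trans ?_
    nlinarith [mul_nonneg (mul_nonneg (sub_nonneg.2 h1.le) (sub_nonneg.2 h2.le)) (sub_nonneg.2 h3),
      mul_nonneg (sub_nonneg.2 h1.le) (sub_nonneg.2 h)]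
  · refine (min_le_right _ _).trans ?_
    nlinarith [mul_nonneg (mul_nonneg (sub_nonneg.2 h1.le) (sub_nonneg.2 h2.le)) (sub_nonneg.2 h3),
      mul_nonneg (sub_nonneg.2 h2.le) (sub_nonneg.2 h)]

lemma sum_sq_defGrad (x : Euc n) :
    ∑ i, defGrad i x ^ 2 = 4 * ‖x‖ ^ 2 * (5 - 2 * ‖x‖ ^ 2) ^ 2 := by
  simp only [defGrad, ← normSq_eq, mul_pow, ← Finset.sum_mul, ← Finset.mul_sum]
  rw [show ∑ i, x i ^ 2 = normSq x from rfl]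
  norm_num

lemma sum_sq_defGrad_ge {x : Euc n} (hx : ‖x‖ = 1 ∨ ‖x‖ = 2) : 36 ≤ ∑ i, defGrad i x ^ 2 := by
  rw [sum_sq_defGrad]
  rcases hx with h | h <;> norm_num [h]

lemma isTest_defFun : IsTest (defFun : Euc n → ℝ) :=
  ⟨.of_contDiff isCompact_closedAnnulus contDiff_defFun, fun _ hx => defFun_eq_zero hx⟩

lemma bddLipOn_defGrad (i : Fin (n + 1)) : BddLipOn (closedAnnulus n) (defGrad i) :=
  .of_contDiff isCompact_closedAnnulus (contDiff_defGrad i)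

lemma bddLipOn_inv_defFun {ε : ℝ} (hε : 0 < ε) :
    BddLipOn (closedAnnulus n) fun x => (defFun x + ε)⁻¹ :=
  (isTest_defFun.bddLip.add (.const ε)).inv hε fun _ hx => by linarith [defFun_nonneg hx]

lemma IsTest.exists_le_defFun {φ : Euc n → ℝ} (h : IsTest φ) :
    ∃ C, 0 ≤ C ∧ ∀ x ∈ annulus n, |φ x| ≤ C * defFun x := by
  obtain ⟨K, hK⟩ := h.bddLip.exists_lipschitzOnWith
  obtain ⟨g, hg, hgφ⟩ := hK.extend_real
  refine ⟨K, K.coe_nonneg, fun x hx => ?_⟩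
  rw [hgφ (annulus_subset_closedAnnulus hx)]
  refine (abs_le_mul_gap hg (fun y hy => ?_) (fun y hy => ?_) hx).trans
    (mul_le_mul_of_nonneg_left (min_le_defFun hx) K.coe_nonneg)
  · rw [← hgφ ⟨hy.ge, by linarith⟩, h.eq_zero y (.inl hy)]
  · rw [← hgφ ⟨by linarith, hy.le⟩, h.eq_zero y (.inr hy)]

lemma integral_sum_partialD_eq_zero {Φ : Fin (n + 1) → Euc n → ℝ} (hΦ : ∀ i, IsTest (Φ i)) :
    ∫ x in annulus n, ∑ i, partialD i (Φ i) x = 0 := by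
  have hone : IntegrableOn (fun _ : Euc n => (1 : ℝ)) (annulus n) :=
    integrableOn_const volume_annulus_lt_top.ne
  have hi : ∀ i, IntegrableOn (fun x => partialD i (Φ i) x) (annulus n) := fun i => by
    simpa using IsMinimal.integrableOn_mul_partialD hone (hΦ i).bddLip i
  rw [integral_finsetSum _ fun i _ => hi i]
  refine Finset.sum_eq_zero fun i _ => ?_
  have h := integral_eq_zero_of_lipschitz_test
    (V := fun _ k => if k = i then (1 : ℝ) else 0) (φ := Φ i) (fun k => ?_) (fun φ h1 h2 h3 => ?_)
    (hΦ i).bddLip (fun x hx => (hΦ i).eq_zero x (.inl hx)) (fun x hx => (hΦ i).eq_zero x (.inr hx))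
  · simpa using h
  · split_ifs
    · exact hone
    · exact integrableOn_zero
  · simp only [ite_mul, one_mul, zero_mul, Finset.sum_ite_eq', Finset.mem_univ, if_true]
    have hsub : Function.support (partialD i φ) ⊆ annulus n := by
      intro x hx
      by_contra hxn
      refine hx ?_
      rw [partialD, fderiv_of_notMem_tsupport ℝ (fun h => hxn (h3 h))]
      rfl
    rw [setIntegral_eq_integral_of_forall_compl_eq_zero
      (fun x hx => Function.notMem_support.1 fun h => hx (hsub h))]
    have hc : Continuous (partialD i φ) := (h1.continuous_fderiv (by simp)).clm_apply continuous_const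
    have hcs : HasCompactSupport (partialD i φ) := h2.fderiv_apply (𝕜 := ℝ) _
    have key := integral_mul_fderiv_eq_neg_fderiv_mul_of_integrable (μ := (volume : Measure (Euc n)))
      (f := fun _ => (1 : ℝ)) (g := φ) (v := EuclideanSpace.single i 1) (by simp)
      (by simp only [one_mul]; exact hc.integrable_of_hasCompactSupport hcs)
      (by simpa using h1.continuous.integrable_of_hasCompactSupport h2)
      (fun _ _ => differentiableAt_const _) (fun x _ => (h1.differentiable (by simp)) x)
    simpa [partialD] using key

lemma continuousOn_layer {ε : ℝ} (hε : 0 < ε) :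
    ContinuousOn (fun x : Euc n => ε / (defFun x + ε) ^ 2) (closedAnnulus n) := by
  refine continuousOn_const.div ((contDiff_defFun.continuous.add continuous_const).pow 2).continuousOn
    fun x hx => ?_
  have := defFun_nonneg hx
  positivity

lemma integrableOn_annulus_of_continuousOn {h : Euc n → ℝ} (hh : ContinuousOn h (closedAnnulus n)) :
    IntegrableOn h (annulus n) :=
  (hh.integrableOn_compact isCompact_closedAnnulus).mono_set annulus_subset_closedAnnulus

/-- The boundary layer `ε |∇ω|² / (ω + ε)²` has bounded mass, depending only on the dimension. -/
lemma exists_layer_bound (n : ℕ) : ∃ C, 0 ≤ C ∧ ∀ ε, 0 < ε →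
    ∫ x in annulus n, ε / (defFun x + ε) ^ 2 * ∑ i, defGrad i x ^ 2 ≤ C := by
  choose K hK0 hK using fun i : Fin (n + 1) => (bddLipOn_defGrad i).exists_bound_partialD
  refine ⟨∫ x in annulus n, ∑ i, K i, integral_nonneg fun x => Finset.sum_nonneg fun i _ => hK0 i,
    fun ε hε => ?_⟩
  set ζ : Euc n → ℝ := fun x => defFun x * (defFun x + ε)⁻¹ with hζ
  have hζt : IsTest ζ := isTest_defFun.mul (bddLipOn_inv_defFun hε)
  have hΦ : ∀ i, IsTest fun x => ζ x * defGrad i x := fun i => hζt.mul (bddLipOn_defGrad i)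
  have h0 := integral_sum_partialD_eq_zero hΦ
  have hK' : IntegrableOn (fun _ : Euc n => ∑ i, K i) (annulus n) :=
    integrableOn_const volume_annulus_lt_top.ne
  have hint : IntegrableOn (fun x => ∑ i, partialD i (fun x => ζ x * defGrad i x) x) (annulus n) :=
    integrable_finsetSum _ fun i _ => by
      have h := IsMinimal.integrableOn_mul_partialD
        (integrableOn_const (C := (1 : ℝ)) volume_annulus_lt_top.ne) (hΦ i).bddLip i
      simp only [one_mul] at h
      exact h
  have hle : ∫ x in annulus n, ε / (defFun x + ε) ^ 2 * ∑ i, defGrad i x ^ 2 ≤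
      ∫ x in annulus n, (∑ i, partialD i (fun x => ζ x * defGrad i x) x + ∑ i, K i) := by
    refine setIntegral_mono_on (integrableOn_annulus_of_continuousOn ((continuousOn_layer hε).mul
      (continuous_finsetSum _ fun i _ => (contDiff_defGrad i).continuous.pow 2).continuousOn))
      (hint.add hK') measurableSet_annulus fun x hx => ?_
    have hω := defFun_pos hx
    rw [Finset.mul_sum, ← Finset.sum_add_distrib]
    refine Finset.sum_le_sum fun i _ => ?_
    have hν : HasPartialAt i (defGrad i) (partialD i (defGrad i) x) x :=
      .of_differentiableAt ((contDiff_defGrad i).differentiable (by simp) x)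
    have hd := ((hasPartialAt_defFun i x).mul
      (((hasPartialAt_defFun i x).add (.const ε)).inv (by positivity))).mul hν
    rw [hd.partialD_eq]
    have hζ1 : |defFun x * (defFun x + ε)⁻¹| ≤ 1 := by
      rw [abs_of_nonneg (by positivity), ← div_eq_mul_inv]
      exact div_le_one_of_le₀ (by linarith) (by positivity)
    have hb : |defFun x * (defFun x + ε)⁻¹ * partialD i (defGrad i) x| ≤ K i := by
      rw [abs_mul]
      exact (mul_le_mul hζ1 (hK i x hx i) (abs_nonneg _) zero_le_one).trans_eq (one_mul _)
    have hb' := (abs_le.1 hb).1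
    have heq : ε / (defFun x + ε) ^ 2 * defGrad i x ^ 2 =
        (defGrad i x * (defFun x + ε)⁻¹ +
          defFun x * (-((defFun x + ε) ^ 2)⁻¹ * (defGrad i x + 0))) * defGrad i x := by
      field_simp
      ring
    rw [heq]
    linarith
  rw [integral_add hint hK', h0, zero_add] at hle
  exact hle

/-- Concentration of the boundary layers on the boundary. -/
lemma exists_layer_integral_le {C : ℝ} (hC0 : 0 ≤ C) (hC : ∀ ε, 0 < ε →
    ∫ x in annulus n, ε / (defFun x + ε) ^ 2 * ∑ i, defGrad i x ^ 2 ≤ C) {h : Euc n → ℝ}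
    (hh : ContinuousOn h (closedAnnulus n)) {b : ℝ} (hb0 : 0 ≤ b)
    (hb : ∀ x, ‖x‖ = 1 ∨ ‖x‖ = 2 → h x ≤ b * ∑ i, defGrad i x ^ 2) {η : ℝ} (hη : 0 < η) :
    ∃ ε₀ > 0, ∀ ε, 0 < ε → ε ≤ ε₀ →
      ∫ x in annulus n, ε / (defFun x + ε) ^ 2 * h x ≤ b * C + η := by
  set η' : ℝ := η / (2 * (C + 1)) with hη'
  have hη'0 : 0 < η' := by positivity
  have hη'C : η' * C ≤ η / 2 := by
    rw [hη', div_mul_eq_mul_div, div_le_div_iff₀ (by positivity) (by positivity)]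
    nlinarith
  have hνc : Continuous fun x : Euc n => ∑ i, defGrad i x ^ 2 :=
    continuous_finsetSum _ fun i _ => (contDiff_defGrad i).continuous.pow 2
  obtain ⟨M, hM⟩ := isCompact_closedAnnulus.exists_bound_of_continuousOn
    (hh.sub (hνc.continuousOn.const_smul (b + η')))
  replace hM : ∀ x ∈ closedAnnulus n, |h x - (b + η') * ∑ i, defGrad i x ^ 2| ≤ M := hM
  obtain ⟨ω₀, hω₀, hT⟩ : ∃ ω₀ > 0, ∀ x ∈ closedAnnulus n,
      (b + η') * ∑ i, defGrad i x ^ 2 ≤ h x → ω₀ ≤ defFun x := by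
    set T : Set (Euc n) := closedAnnulus n ∩
      (fun x => h x - (b + η') * ∑ i, defGrad i x ^ 2) ⁻¹' Ici 0
    have hTc : IsCompact T := isCompact_closedAnnulus.of_isClosed_subset
      ((hh.sub (hνc.continuousOn.const_smul (b + η'))).preimage_isClosed_of_isClosed
        isCompact_closedAnnulus.isClosed isClosed_Ici) inter_subset_left
    rcases T.eq_empty_or_nonempty with hTe | hTn
    · refine ⟨1, one_pos, fun x hx hxh => ?_⟩
      have : x ∈ T := ⟨hx, sub_nonneg.2 hxh⟩
      simp [hTe] at this
    · obtain ⟨y, hy, hmin⟩ := hTc.exists_isMinOn hTn contDiff_defFun.continuous.continuousOn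
      refine ⟨defFun y, ?_, fun x hx hxh => hmin ⟨hx, sub_nonneg.2 hxh⟩⟩
      refine defFun_pos ⟨lt_of_le_of_ne hy.1.1 fun h1 => ?_, lt_of_le_of_ne hy.1.2 fun h2 => ?_⟩
      · have h3 := hb y (.inl h1.symm)
        have h4 := sum_sq_defGrad_ge (.inl h1.symm : ‖y‖ = 1 ∨ ‖y‖ = 2)
        have h5 : 0 ≤ h y - (b + η') * ∑ i, defGrad i y ^ 2 := hy.2
        nlinarith
      · have h3 := hb y (.inr h2)
        have h4 := sum_sq_defGrad_ge (.inr h2 : ‖y‖ = 1 ∨ ‖y‖ = 2)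
        have h5 : 0 ≤ h y - (b + η') * ∑ i, defGrad i y ^ 2 := hy.2
        nlinarith
  set v := volume.real (annulus n) with hv
  have hv0 : 0 ≤ v := measureReal_nonneg
  have hbound : ∀ ε, 0 < ε → ∫ x in annulus n, ε / (defFun x + ε) ^ 2 * h x ≤
      (b + η') * (∫ x in annulus n, ε / (defFun x + ε) ^ 2 * ∑ i, defGrad i x ^ 2) +
        ε * (|M| / ω₀ ^ 2 * v) := by
    intro ε hε
    have i1 : IntegrableOn (fun x : Euc n => ε / (defFun x + ε) ^ 2 * ∑ i, defGrad i x ^ 2)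
        (annulus n) := integrableOn_annulus_of_continuousOn
      ((continuousOn_layer hε).mul hνc.continuousOn)
    have i2 : IntegrableOn (fun _ : Euc n => ε * (|M| / ω₀ ^ 2)) (annulus n) :=
      integrableOn_const volume_annulus_lt_top.ne
    calc ∫ x in annulus n, ε / (defFun x + ε) ^ 2 * h x
        ≤ ∫ x in annulus n, ((b + η') * (ε / (defFun x + ε) ^ 2 * ∑ i, defGrad i x ^ 2) +
          ε * (|M| / ω₀ ^ 2)) := by
          refine setIntegral_mono_on (integrableOn_annulus_of_continuousOn
            ((continuousOn_layer hε).mul hh)) ((i1.const_mul _).add i2) measurableSet_annulus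
            fun x hx => ?_
          have hω := defFun_pos hx
          have hl : 0 ≤ ε / (defFun x + ε) ^ 2 := by positivity
          rcases le_total ((b + η') * ∑ i, defGrad i x ^ 2) (h x) with h1 | h1
          · have h2 := hT x (annulus_subset_closedAnnulus hx) h1
            have h3 := (le_abs_self _).trans ((hM x (annulus_subset_closedAnnulus hx)).trans
              (le_abs_self M))
            have h4 : ε / (defFun x + ε) ^ 2 ≤ ε / ω₀ ^ 2 := by
              gcongr
              linarith
            have h5 := mul_le_mul h4 h3 (sub_nonneg.2 h1) (by positivity)
            have h6 : ε / ω₀ ^ 2 * |M| = ε * (|M| / ω₀ ^ 2) := by ring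
            rw [h6, mul_sub] at h5
            linarith
          · have h2 := mul_le_mul_of_nonneg_left h1 hl
            have h3 : 0 ≤ ε * (|M| / ω₀ ^ 2) := by positivity
            linarith
      _ = _ := by
          rw [integral_add (i1.const_mul _) i2, integral_const_mul, setIntegral_const, smul_eq_mul]
          ring
  refine ⟨η / 2 / (|M| / ω₀ ^ 2 * v + 1), by positivity, fun ε hε hle => ?_⟩
  have h1 := mul_le_mul_of_nonneg_left (hC ε hε) (by positivity : 0 ≤ b + η')
  rw [le_div_iff₀ (by positivity)] at hle
  linarith [hbound ε hε]

end BoundaryLayer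

section BoundaryRegularity

open scoped NNReal
open Filter Topology Set

variable {n : ℕ} {κ : Type*} [Fintype κ]

/-- The unit radial vector. -/
noncomputable def unitVec (x : Euc n) : Fin (n + 1) → ℝ := fun i => x i / ‖x‖

/-- The projection onto the tangent space of the sphere through `x`. -/
noncomputable def tangProj (x : Euc n) : Matrix (Fin (n + 1)) (Fin (n + 1)) ℝ :=
  1 - Matrix.vecMulVec (unitVec x) (unitVec x)

/-- The squared norm of the tangential part of the Jacobian matrix. -/
noncomputable def tangEnergy (G : κ → Euc n → ℝ) (x : Euc n) : ℝ :=
  ∑ a, ∑ i, (jac G x * tangProj x) a i ^ 2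

lemma unitVec_dotProduct_self {x : Euc n} (hx : x ≠ 0) : unitVec x ⬝ᵥ unitVec x = 1 := by
  have h : ‖x‖ ≠ 0 := norm_ne_zero_iff.2 hx
  have h2 := EuclideanSpace.real_norm_sq_eq x
  simp only [unitVec, dotProduct, ← sq, div_pow, ← Finset.sum_div]
  rw [← h2]
  exact div_self (pow_ne_zero 2 h)

lemma mul_one_sub_vecMulVec_apply {κ ι : Type*} [Fintype ι] [DecidableEq ι] (M : Matrix κ ι ℝ)
    (e : ι → ℝ) (a : κ) (i : ι) :
    (M * (1 - Matrix.vecMulVec e e) : Matrix κ ι ℝ) a i = M a i - (M a ⬝ᵥ e) * e i := by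
  rw [Matrix.mul_sub, Matrix.mul_one, Matrix.mul_vecMulVec]
  rfl

lemma sum_sq_mul_one_sub_vecMulVec_le {κ ι : Type*} [Fintype ι] [DecidableEq ι] (M : Matrix κ ι ℝ)
    {e : ι → ℝ} (he : e ⬝ᵥ e = 1) (a : κ) (c : ℝ) :
    ∑ i, (M * (1 - Matrix.vecMulVec e e) : Matrix κ ι ℝ) a i ^ 2 ≤ ∑ i, (M a i - c * e i) ^ 2 := by
  have h : ∀ d : ℝ, ∑ i, (M a i - d * e i) ^ 2 = M a ⬝ᵥ M a - 2 * d * (M a ⬝ᵥ e) + d ^ 2 := by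
    intro d
    rw [← mul_one (d ^ 2), ← he]
    simp only [dotProduct, Finset.mul_sum, ← Finset.sum_sub_distrib, ← Finset.sum_add_distrib]
    exact Finset.sum_congr rfl fun i _ => by ring
  simp only [mul_one_sub_vecMulVec_apply]
  rw [h, h]
  nlinarith [sq_nonneg (M a ⬝ᵥ e - c)]

lemma measurable_tangProj (i j : Fin (n + 1)) : Measurable fun x : Euc n => tangProj x i j := by
  have h : ∀ i, Measurable fun x : Euc n => unitVec x i := fun i => by
    have h1 : Continuous fun x : Euc n => x i := by fun_prop
    exact h1.measurable.div measurable_norm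
  exact measurable_const.sub ((h i).mul (h j))

lemma measurable_jac_mul_tangProj {κ : Type*} (G : κ → Euc n → ℝ) :
    Measurable fun x => (fun a i => (jac G x * tangProj x) a i : κ → Fin (n + 1) → ℝ) := by
  refine measurable_pi_lambda _ fun a => measurable_pi_lambda _ fun i => ?_
  simp only [Matrix.mul_apply]
  exact Finset.measurable_fun_sum _ fun k _ => (measurable_partialD _ _).mul (measurable_tangProj k i)

lemma measurable_tangEnergy (G : κ → Euc n → ℝ) : Measurable (tangEnergy G) := by
  have h := measurable_jac_mul_tangProj G
  exact Finset.measurable_fun_sum _ fun a _ => Finset.measurable_fun_sum _ fun i _ =>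
    ((measurable_pi_iff.1 (measurable_pi_iff.1 h a)) i).pow_const 2

lemma tangEnergy_nonneg (G : κ → Euc n → ℝ) (x : Euc n) : 0 ≤ tangEnergy G x :=
  Finset.sum_nonneg fun _ _ => Finset.sum_nonneg fun _ _ => sq_nonneg _

lemma ne_zero_of_mem_annulus {x : Euc n} (hx : x ∈ annulus n) : x ≠ 0 :=
  norm_pos_iff.1 (one_pos.trans hx.1)

lemma abs_jac_mul_tangProj_le {κ : Type*} {G : κ → Euc n → ℝ} {K : ℝ} {x : Euc n} (hx : x ≠ 0)
    (hG : ∀ a i, |partialD i (G a) x| ≤ K) (a : κ) (i : Fin (n + 1)) :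
    |(jac G x * tangProj x) a i| ≤ (n + 1) * K := by
  have hK : 0 ≤ K := (abs_nonneg _).trans (hG a i)
  have h := sum_sq_mul_one_sub_vecMulVec_le (jac G x) (unitVec_dotProduct_self hx) a 0
  have h2 : ∑ i, (jac G x a i - 0 * unitVec x i) ^ 2 ≤ ((n + 1) * K) ^ 2 := by
    calc _ ≤ ∑ _i : Fin (n + 1), K ^ 2 := Finset.sum_le_sum fun i _ => by
            rw [zero_mul, sub_zero, ← sq_abs]
            exact pow_le_pow_left₀ (abs_nonneg _) (hG a i) 2
      _ = (n + 1) * K ^ 2 := by simp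
      _ ≤ ((n + 1) * K) ^ 2 := by
          have : (0 : ℝ) ≤ n := n.cast_nonneg
          nlinarith [sq_nonneg K, mul_nonneg this (sq_nonneg K)]
  refine abs_le_of_sq_le_sq ?_ (by positivity)
  exact (Finset.single_le_sum (f := fun i => (jac G x * tangProj x) a i ^ 2)
    (fun _ _ => sq_nonneg _) (Finset.mem_univ i)).trans (h.trans h2)

lemma contDiff_partialD {f : Euc n → ℝ} (hf : ContDiff ℝ 2 f) (i : Fin (n + 1)) :
    ContDiff ℝ 1 (partialD i f) :=
  (hf.fderiv_right (by norm_num)).clm_apply contDiff_const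

lemma isTest_sub {F f : Euc n → ℝ} (hF : BddLipOn (closedAnnulus n) F) (hf : ContDiff ℝ 2 f)
    (h : ∀ x, ‖x‖ = 1 ∨ ‖x‖ = 2 → F x = f x) : IsTest fun x => F x - f x :=
  ⟨hF.sub (.of_contDiff isCompact_closedAnnulus (hf.of_le (by norm_num))),
    fun x hx => sub_eq_zero.2 (h x hx)⟩

lemma IsTest.sum {ι : Type*} (s : Finset ι) {φ : ι → Euc n → ℝ} (h : ∀ k, IsTest (φ k)) :
    IsTest fun x => ∑ k ∈ s, φ k x :=
  ⟨.sum s fun k => (h k).bddLip, fun x hx => Finset.sum_eq_zero fun k _ => (h k).eq_zero x hx⟩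

namespace IsMinimal

variable {F f : κ → Euc n → ℝ}

lemma exists_tangEnergy_bound (hF : IsMinimal F) (hf : ∀ a, ContDiff ℝ 2 (f a)) :
    ∃ K, 0 ≤ K ∧ ∀ x ∈ annulus n, tangEnergy (fun a x => F a x - f a x) x ≤ K := by
  choose K hK0 hK using fun a => ((hF.bddLipOn a).sub (.of_contDiff isCompact_closedAnnulus
    ((hf a).of_le (by norm_num)))).exists_bound_partialD
  refine ⟨∑ _a : κ, ∑ _i : Fin (n + 1), ((n + 1) * ∑ b, K b) ^ 2, by positivity, fun x hx => ?_⟩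
  refine Finset.sum_le_sum fun a _ => Finset.sum_le_sum fun i _ => ?_
  rw [← sq_abs]
  refine pow_le_pow_left₀ (abs_nonneg _) (abs_jac_mul_tangProj_le (ne_zero_of_mem_annulus hx)
    (fun a i => (hK a x hx i).trans ?_) a i) 2
  exact Finset.single_le_sum (fun b _ => hK0 b) (Finset.mem_univ a)

lemma integrableOn_mul_tangEnergy (hF : IsMinimal F) (hf : ∀ a, ContDiff ℝ 2 (f a)) {u : Euc n → ℝ}
    (hu : ContinuousOn u (closedAnnulus n)) :
    IntegrableOn (fun x => u x * tangEnergy (fun a x => F a x - f a x) x) (annulus n) := by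
  obtain ⟨K, hK0, hK⟩ := hF.exists_tangEnergy_bound hf
  refine (integrableOn_annulus_of_continuousOn hu).mul_bdd (c := K)
    (measurable_tangEnergy _).aestronglyMeasurable
    ((ae_restrict_iff' measurableSet_annulus).2 (ae_of_all _ fun x hx => ?_))
  rw [Real.norm_eq_abs, abs_of_nonneg (tangEnergy_nonneg _ _)]
  exact hK x hx

lemma exists_integral_tangEnergy_le (hF : IsMinimal F) (hf : ∀ a, ContDiff ℝ 2 (f a))
    (hFf : ∀ a x, ‖x‖ = 1 ∨ ‖x‖ = 2 → F a x = f a x) :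
    ∃ C, ∀ ε, 0 < ε → ∫ x in annulus n, (defFun x + ε)⁻¹ *
      tangEnergy (fun a x => F a x - f a x) x ≤ C := by
  set G : κ → Euc n → ℝ := fun a x => F a x - f a x with hG
  have hGt : ∀ a, IsTest (G a) := fun a => isTest_sub (hF.bddLipOn a) (hf a) (hFf a)
  obtain ⟨C, hC0, -, hC⟩ := hF.exists_bounds
  choose B hB0 hB using fun a => (hGt a).exists_le_defFun
  choose N hN0 hN using fun i : Fin (n + 1) => (bddLipOn_defGrad i).exists_bound_partialD
  have hf1 : ∀ a j, BddLipOn (closedAnnulus n) (partialD j (f a)) := fun a j =>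
    .of_contDiff isCompact_closedAnnulus (contDiff_partialD (hf a) j)
  choose H hH0 hH using fun a j => (hf1 a j).exists_bound_partialD
  set Λ : ℝ := 1 + ∑ _a : κ, ∑ _i : Fin (n + 1), C ^ 2 with hΛ
  have hΛ0 : 0 < Λ := by positivity
  set Q : ℝ := ∑ i : Fin (n + 1), ∑ j, ∑ a, C * (H a j * B a + N j * B a ^ 2 * (1 / 2)) with hQ
  refine ⟨Λ * (volume.real (annulus n) * Q), fun ε hε => ?_⟩
  set P : Euc n → ℝ := fun x => (defFun x + ε)⁻¹ with hP
  have hPb : BddLipOn (closedAnnulus n) P := bddLipOn_inv_defFun hε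
  have hΨ : ∀ a, IsTest fun x => G a x * P x := fun a => (hGt a).mul hPb
  have hΦ : ∀ j, IsTest fun x => ∑ a, G a x * P x *
      (-partialD j (f a) x - defGrad j x * (G a x * P x) * (1 / 2)) := fun j =>
    IsTest.sum _ fun a => (hΨ a).mul ((hf1 a j).neg.sub
      (((bddLipOn_defGrad j).mul (hΨ a).bddLip).mul (.const _)))
  obtain ⟨hint, h0⟩ := hF.stationary hΦ hΨ
  set I : Euc n → ℝ := fun x => ∑ i, ∑ j, coef (jac F x) i j *
      (partialD i (fun x => ∑ a, G a x * P x *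
      (-partialD j (f a) x - defGrad j x * (G a x * P x) * (1 / 2))) x +
        ∑ a, partialD j (F a) x * partialD i (fun x => G a x * P x) x) with hI
  have hQi : IntegrableOn (fun _ : Euc n => Q) (annulus n) :=
    integrableOn_const volume_annulus_lt_top.ne
  have hPE : IntegrableOn (fun x => P x * tangEnergy G x) (annulus n) :=
    hF.integrableOn_mul_tangEnergy hf hPb.continuousOn
  have hmain : ∫ x in annulus n, Λ⁻¹ * (P x * tangEnergy G x) ≤ ∫ x in annulus n, (I x + Q) := by
    refine integral_mono_ae (hPE.const_mul _) (hint.add hQi) ?_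
    refine (ae_restrict_iff' measurableSet_annulus).2 ?_
    filter_upwards [hF.ae_differentiableAt] with x hdiff hx
    have hω := defFun_pos hx
    have hP0 : 0 < P x := by simp only [hP]; positivity
    have hFd : ∀ a i, HasPartialAt i (F a) (partialD i (F a) x) x := fun a i =>
      .of_differentiableAt (hdiff a)
    have hfd : ∀ a i, HasPartialAt i (f a) (partialD i (f a) x) x := fun a i =>
      .of_differentiableAt ((hf a).differentiable (by simp) x)
    have hGd : ∀ a i, HasPartialAt i (G a) (partialD i (F a) x - partialD i (f a) x) x := fun a i =>
      (hFd a i).sub (hfd a i)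
    have hf2 : ∀ a i j, HasPartialAt i (partialD j (f a)) (partialD i (partialD j (f a)) x) x :=
      fun a i j => .of_differentiableAt ((contDiff_partialD (hf a) j).differentiable (by simp) x)
    have hν : ∀ i j, HasPartialAt i (defGrad j) (partialD i (defGrad j) x) x := fun i j =>
      .of_differentiableAt ((contDiff_defGrad j).differentiable (by simp) x)
    have hPd : ∀ i, HasPartialAt i P (-P x ^ 2 * defGrad i x) x := fun i => by
      have h := ((hasPartialAt_defFun i x).add (.const ε)).inv (by positivity)
      refine h.congr_value ?_
      simp only [hP, inv_pow, add_zero]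
    set W : κ → Fin (n + 1) → ℝ := fun a i =>
      (partialD i (F a) x - partialD i (f a) x) - defGrad i x * (G a x * P x) with hW
    have hΨd : ∀ a i, HasPartialAt i (fun x => G a x * P x) (P x * W a i) x := fun a i =>
      ((hGd a i).mul (hPd i)).congr_value (by simp only [hW]; ring)
    have hΦd : ∀ i j, HasPartialAt i (fun x => ∑ a, G a x * P x *
      (-partialD j (f a) x - defGrad j x * (G a x * P x) * (1 / 2))) _ x := fun i j =>
      HasPartialAt.sum Finset.univ fun a _ => (hΨd a i).mul ((hf2 a i j).neg.sub
        (((hν i j).mul (hΨd a i)).mul (.const (1 / 2))))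
    have hIx : I x = P x * ∑ a, W a ⬝ᵥ (coef (jac F x)).mulVec (W a) - ∑ i, ∑ j, ∑ a,
        coef (jac F x) i j * (partialD i (partialD j (f a)) x * (G a x * P x) +
          partialD i (defGrad j) x * (G a x * P x) ^ 2 * (1 / 2)) := by
      have h1 : ∑ a, W a ⬝ᵥ (coef (jac F x)).mulVec (W a) =
          ∑ i, ∑ j, ∑ a, coef (jac F x) i j * (W a i * W a j) := by
        simp only [dotProduct, Matrix.mulVec, Finset.mul_sum]
        rw [Finset.sum_comm]
        refine Finset.sum_congr rfl fun i _ => ?_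
        rw [Finset.sum_comm]
        exact Finset.sum_congr rfl fun j _ => Finset.sum_congr rfl fun a _ => by ring
      rw [h1, Finset.mul_sum, ← Finset.sum_sub_distrib]
      refine Finset.sum_congr rfl fun i _ => ?_
      rw [Finset.mul_sum, ← Finset.sum_sub_distrib]
      refine Finset.sum_congr rfl fun j _ => ?_
      rw [(hΦd i j).partialD_eq, ← Finset.sum_add_distrib, Finset.mul_sum, Finset.mul_sum,
        ← Finset.sum_sub_distrib]
      refine Finset.sum_congr rfl fun a _ => ?_
      rw [(hΨd a i).partialD_eq]
      simp only [hW]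
      ring
    have hGP : ∀ a, |G a x * P x| ≤ B a := fun a => by
      rw [abs_mul, abs_of_pos hP0]
      simp only [hP]
      rw [← div_eq_mul_inv, div_le_iff₀ (by positivity)]
      exact (hB a x hx).trans (mul_le_mul_of_nonneg_left (by linarith) (hB0 a))
    have hrest : ∑ i, ∑ j, ∑ a,
        coef (jac F x) i j * (partialD i (partialD j (f a)) x * (G a x * P x) +
          partialD i (defGrad j) x * (G a x * P x) ^ 2 * (1 / 2)) ≤ Q := by
      refine Finset.sum_le_sum fun i _ => Finset.sum_le_sum fun j _ => Finset.sum_le_sum fun a _ => ?_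
      refine (le_abs_self _).trans ?_
      rw [abs_mul]
      refine mul_le_mul ((hC x).2.1 i j) ?_ (abs_nonneg _) hC0
      refine (abs_add_le _ _).trans (add_le_add ?_ ?_)
      · rw [abs_mul]
        exact mul_le_mul (hH a j x hx i) (hGP a) (abs_nonneg _) (hH0 a j)
      · rw [abs_mul, abs_mul, abs_pow, abs_of_pos (by norm_num : (0 : ℝ) < 1 / 2)]
        have := pow_le_pow_left₀ (abs_nonneg _) (hGP a) 2
        exact mul_le_mul_of_nonneg_right (mul_le_mul (hN j x hx i) this (by positivity) (hN0 j))
          (by norm_num)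
    have hell : ∀ a, ∑ i, (jac G x * tangProj x) a i ^ 2 ≤
        Λ * (W a ⬝ᵥ (coef (jac F x)).mulVec (W a)) := fun a => by
      have h1 := sum_sq_mul_one_sub_vecMulVec_le (jac G x)
        (unitVec_dotProduct_self (ne_zero_of_mem_annulus hx)) a
        (2 * ‖x‖ * (5 - 2 * normSq x) * (G a x * P x))
      have hxn : ‖x‖ ≠ 0 := norm_ne_zero_iff.2 (ne_zero_of_mem_annulus hx)
      have h2 : ∑ i, (jac G x a i - 2 * ‖x‖ * (5 - 2 * normSq x) * (G a x * P x) * unitVec x i) ^ 2 =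
          W a ⬝ᵥ W a := by
        refine Finset.sum_congr rfl fun i _ => ?_
        have h3 : jac G x a i = partialD i (F a) x - partialD i (f a) x := (hGd a i).partialD_eq
        rw [h3]
        simp only [hW, unitVec, defGrad]
        field_simp
      rw [h2] at h1
      refine h1.trans ((dotProduct_self_le_coef (jac F x) (W a)).trans ?_)
      have h4 : 0 ≤ W a ⬝ᵥ (coef (jac F x)).mulVec (W a) := by
        have h5 := dotProduct_self_le_coef (jac F x) (W a)
        have h6 : 0 ≤ W a ⬝ᵥ W a := Finset.sum_nonneg fun _ _ => mul_self_nonneg _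
        exact nonneg_of_mul_nonneg_right (h6.trans h5) (by positivity)
      refine mul_le_mul_of_nonneg_right ?_ h4
      refine add_le_add le_rfl (Finset.sum_le_sum fun a _ => Finset.sum_le_sum fun i _ => ?_)
      rw [← sq_abs]
      exact pow_le_pow_left₀ (abs_nonneg _) ((hC x).1 a i) 2
    have hsum : Λ⁻¹ * tangEnergy G x ≤ ∑ a, W a ⬝ᵥ (coef (jac F x)).mulVec (W a) := by
      rw [inv_mul_le_iff₀ hΛ0, Finset.mul_sum]
      exact Finset.sum_le_sum fun a _ => hell a
    have hfin := mul_le_mul_of_nonneg_left hsum hP0.le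
    rw [hIx]
    calc Λ⁻¹ * (P x * tangEnergy G x) = P x * (Λ⁻¹ * tangEnergy G x) := by ring
      _ ≤ _ := by linarith
  rw [integral_add hint hQi, h0, zero_add, setIntegral_const, smul_eq_mul, integral_const_mul,
    inv_mul_le_iff₀ hΛ0] at hmain
  exact hmain

/-- The tangential part of the boundary error does not contribute to the boundary layer. -/
theorem tendsto_layer_tangEnergy (hF : IsMinimal F) (hf : ∀ a, ContDiff ℝ 2 (f a))
    (hFf : ∀ a x, ‖x‖ = 1 ∨ ‖x‖ = 2 → F a x = f a x) {ε : ℕ → ℝ} (hε : ∀ k, 0 < ε k)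
    (hε0 : Tendsto ε atTop (𝓝 0)) :
    Tendsto (fun k => ∫ x in annulus n, ε k / (defFun x + ε k) ^ 2 *
      tangEnergy (fun a x => F a x - f a x) x) atTop (𝓝 0) := by
  obtain ⟨C, hC⟩ := hF.exists_integral_tangEnergy_le hf hFf
  set E := tangEnergy fun a x => F a x - f a x with hE
  have hE0 : ∀ x, 0 ≤ E x := tangEnergy_nonneg _
  have hEm : Measurable E := measurable_tangEnergy _
  have hωm : Measurable (defFun : Euc n → ℝ) := contDiff_defFun.continuous.measurable
  have hlim : ∀ᵐ x ∂volume.restrict (annulus n),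
      Tendsto (fun k => (defFun x + ε k)⁻¹ * E x) atTop (𝓝 ((defFun x)⁻¹ * E x)) := by
    refine (ae_restrict_iff' measurableSet_annulus).2 (ae_of_all _ fun x hx => ?_)
    have h1 : Tendsto (fun k => defFun x + ε k) atTop (𝓝 (defFun x)) := by
      simpa using tendsto_const_nhds.add hε0
    exact (h1.inv₀ (defFun_pos hx).ne').mul tendsto_const_nhds
  have hint : IntegrableOn (fun x => (defFun x)⁻¹ * E x) (annulus n) := by
    refine ⟨(hωm.inv.mul hEm).aestronglyMeasurable, lt_of_le_of_lt ?_
      (ENNReal.ofReal_lt_top (r := C))⟩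
    have hfatou := lintegral_liminf_le (μ := volume.restrict (annulus n)) (u := atTop) fun k : ℕ =>
      ((hωm.add_const (ε k)).inv.mul hEm).enorm
    have hcongr := lintegral_congr_ae (hlim.mono fun x hx => hx.enorm.liminf_eq)
    refine (hcongr.symm.trans_le hfatou).trans ?_
    refine (liminf_le_limsup).trans (limsup_le_of_le (h := Eventually.of_forall fun k => ?_))
    have hI : IntegrableOn (fun x => (defFun x + ε k)⁻¹ * E x) (annulus n) :=
      hF.integrableOn_mul_tangEnergy hf (bddLipOn_inv_defFun (hε k)).continuousOn
    refine (ofReal_integral_norm_eq_lintegral_enorm hI).symm.trans_le ?_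
    refine ENNReal.ofReal_le_ofReal (le_of_eq_of_le ?_ (hC (ε k) (hε k)))
    refine setIntegral_congr_fun measurableSet_annulus fun x hx => ?_
    have := defFun_pos hx
    have := hε k
    exact Real.norm_of_nonneg (mul_nonneg (by positivity) (hE0 x))
  have hz : (0 : ℝ) = ∫ x in annulus n, (0 : ℝ) := by simp
  rw [hz]
  refine tendsto_integral_of_dominated_convergence (fun x => (defFun x)⁻¹ * E x) (fun k =>
    ((measurable_const.div ((hωm.add_const _).pow_const 2)).mul hEm).aestronglyMeasurable)
    hint (fun k => (ae_restrict_iff' measurableSet_annulus).2 (ae_of_all _ fun x hx => ?_))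
    ((ae_restrict_iff' measurableSet_annulus).2 (ae_of_all _ fun x hx => ?_))
  · have h1 := defFun_pos hx
    have h2 := hε k
    rw [Real.norm_of_nonneg (mul_nonneg (by positivity) (hE0 x))]
    refine mul_le_mul_of_nonneg_right ?_ (hE0 x)
    rw [div_le_iff₀ (by positivity), inv_mul_eq_div, le_div_iff₀ h1]
    nlinarith
  · have h1 := defFun_pos hx
    have h2 : Tendsto (fun k => ε k / (defFun x + ε k) ^ 2) atTop (𝓝 (0 / (defFun x + 0) ^ 2)) :=
      hε0.div ((tendsto_const_nhds.add hε0).pow 2) (by simpa using h1.ne')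
    simpa using h2.mul_const (E x)

end IsMinimal

end BoundaryRegularity

section FirstVariation

open Matrix

variable {ι κ : Type*} [Fintype ι] [Fintype κ] [DecidableEq ι]

lemma sum_coef_mul_eq (D : Matrix κ ι ℝ) (y q : ι → ℝ) (u : κ → ℝ) (t : ℝ) :
    ∑ i, ∑ j, coef D i j * ((q i * y j + t * if j = i then 1 else 0) +
      ∑ a, D a j * (q i * u a + t * D a i)) =
    area D * (q ⬝ᵥ ((graphMetric D)⁻¹ *ᵥ (y + Dᵀ *ᵥ u))) + t * (Fintype.card ι * area D) := by
  rw [← trace_coef_mul_graphMetric D]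
  have h1 : area D * (q ⬝ᵥ ((graphMetric D)⁻¹ *ᵥ (y + Dᵀ *ᵥ u))) =
      q ⬝ᵥ (coef D *ᵥ (y + Dᵀ *ᵥ u)) := by
    rw [coef, smul_mulVec, dotProduct_smul, smul_eq_mul]
  rw [h1, trace, dotProduct, Finset.mul_sum, ← Finset.sum_add_distrib]
  refine Finset.sum_congr rfl fun i _ => ?_
  rw [mulVec, dotProduct, Finset.mul_sum, diag_apply, mul_apply, Finset.mul_sum,
    ← Finset.sum_add_distrib]
  refine Finset.sum_congr rfl fun j _ => ?_
  have h2 : graphMetric D j i = (if j = i then 1 else 0) + ∑ a, D a j * D a i := by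
    rw [graphMetric, Matrix.add_apply, one_apply, mul_apply]
    rfl
  have h3 : (y + Dᵀ *ᵥ u) j = y j + ∑ a, D a j * u a := rfl
  have h4 : ∑ a, D a j * (q i * u a + t * D a i) =
      q i * ∑ a, D a j * u a + t * ∑ a, D a j * D a i := by
    rw [Finset.mul_sum, Finset.mul_sum, ← Finset.sum_add_distrib]
    exact Finset.sum_congr rfl fun a _ => by ring
  rw [h2, h3, h4]
  ring

lemma area_mul_abs_dotProduct_le (D : Matrix κ ι ℝ) (y e : ι → ℝ) (u : κ → ℝ) (he : e ⬝ᵥ e = 1) :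
    area D * |e ⬝ᵥ ((graphMetric D)⁻¹ *ᵥ (y + Dᵀ *ᵥ u))| ≤
      area (D * (1 - vecMulVec e e)) * √(y ⬝ᵥ y + u ⬝ᵥ u) := by
  have hsymm : e ⬝ᵥ ((graphMetric D)⁻¹ *ᵥ (y + Dᵀ *ᵥ u)) =
      (y + Dᵀ *ᵥ u) ⬝ᵥ ((graphMetric D)⁻¹ *ᵥ e) := by
    rw [dotProduct_mulVec, ← mulVec_transpose, transpose_nonsing_inv, transpose_graphMetric,
      dotProduct_comm]
  have h0 : 0 ≤ y ⬝ᵥ y + u ⬝ᵥ u := add_nonneg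
    (Finset.sum_nonneg fun _ _ => mul_self_nonneg _) (Finset.sum_nonneg fun _ _ => mul_self_nonneg _)
  rw [← area_mul_sqrt_inv_graphMetric D e he, mul_assoc, mul_comm (√_) (√_), ← Real.sqrt_mul h0, hsymm]
  exact mul_le_mul_of_nonneg_left (Real.abs_le_sqrt (sq_dotProduct_inv_graphMetric_le D y e u))
    (zero_le_one.trans (one_le_area D))

/-- The pointwise inequality behind the monotonicity formula. -/
lemma monotonicity_integrand_le (D : Matrix κ ι ℝ) (y e : ι → ℝ) (u : κ → ℝ) (he : e ⬝ᵥ e = 1)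
    {p l ζ ρ τ : ℝ} (hp : 0 ≤ p) (hζ : 0 ≤ ζ) (hρ : 0 < ρ)
    (hρ2 : ρ ^ 2 = y ⬝ᵥ y + u ⬝ᵥ u + τ ^ 2) {q : ι → ℝ} {N : ℕ} (hN : Fintype.card ι = N)
    (hq : ∀ i, q i = p * l * (ρ ^ N)⁻¹ * e i - ζ * N * (ρ ^ (N + 2))⁻¹ * (y + Dᵀ *ᵥ u) i) :
    ζ * (N * (area D * (τ ^ 2 / ρ ^ (N + 2)))) ≤
      ∑ i, ∑ j, coef D i j * ((q i * y j + ζ * (ρ ^ N)⁻¹ * if j = i then 1 else 0) +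
        ∑ a, D a j * (q i * u a + ζ * (ρ ^ N)⁻¹ * D a i)) +
      p * (|l| * area (D * (1 - vecMulVec e e)) * (√(y ⬝ᵥ y + u ⬝ᵥ u) / ρ ^ N)) := by
  set w := y + Dᵀ *ᵥ u with hw
  have hqw : q ⬝ᵥ ((graphMetric D)⁻¹ *ᵥ w) =
      p * l * (ρ ^ N)⁻¹ * (e ⬝ᵥ ((graphMetric D)⁻¹ *ᵥ w)) -
        ζ * N * (ρ ^ (N + 2))⁻¹ * (w ⬝ᵥ ((graphMetric D)⁻¹ *ᵥ w)) := by
    have : q = (p * l * (ρ ^ N)⁻¹) • e - (ζ * N * (ρ ^ (N + 2))⁻¹) • w := funext hq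
    rw [this, sub_dotProduct, smul_dotProduct, smul_dotProduct, smul_eq_mul, smul_eq_mul]
  rw [sum_coef_mul_eq, hqw, hN]
  have hA := zero_le_one.trans (one_le_area D)
  have h1 := dotProduct_inv_graphMetric_self_le D y u
  have h2 := area_mul_abs_dotProduct_le D y e u he
  rw [← hw] at h1 h2
  set X := e ⬝ᵥ ((graphMetric D)⁻¹ *ᵥ w)
  set Y := w ⬝ᵥ ((graphMetric D)⁻¹ *ᵥ w)
  set S := y ⬝ᵥ y + u ⬝ᵥ u
  have h3 : -(p * (|l| * area (D * (1 - vecMulVec e e)) * (√S / ρ ^ N))) ≤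
      area D * (p * l * (ρ ^ N)⁻¹ * X) := by
    have h4 : -(|l| * |X|) ≤ l * X := by rw [← abs_mul]; exact neg_abs_le _
    have h5 : (p * (ρ ^ N)⁻¹ * |l|) * (area D * |X|) ≤
        (p * (ρ ^ N)⁻¹ * |l|) * (area (D * (1 - vecMulVec e e)) * √S) :=
      mul_le_mul_of_nonneg_left h2 (by positivity)
    have h6 : (p * (ρ ^ N)⁻¹ * area D) * -(|l| * |X|) ≤ (p * (ρ ^ N)⁻¹ * area D) * (l * X) :=
      mul_le_mul_of_nonneg_left h4 (by positivity)
    rw [div_eq_mul_inv]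
    linarith
  have h7 : ζ * N * (ρ ^ (N + 2))⁻¹ * area D * Y ≤ ζ * N * (ρ ^ (N + 2))⁻¹ * area D * S :=
    mul_le_mul_of_nonneg_left h1 (by positivity)
  have h8 : (ρ ^ N)⁻¹ = (S + τ ^ 2) * (ρ ^ (N + 2))⁻¹ := by
    rw [← hρ2, pow_add]
    field_simp
  have h9 : ζ * (ρ ^ N)⁻¹ * (N * area D) - ζ * N * (ρ ^ (N + 2))⁻¹ * area D * S =
      ζ * (N * (area D * (τ ^ 2 / ρ ^ (N + 2)))) := by
    rw [h8, div_eq_mul_inv]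
    ring
  rw [← h9, mul_sub]
  linarith

end FirstVariation

section Monotonicity

open scoped NNReal
open Filter Topology Set

variable {n : ℕ} {κ : Type*} [Fintype κ]

/-- The squared distance of `(x, F x)` from `(x₀, c)`. -/
def sepSq (F : κ → Euc n → ℝ) (x₀ : Euc n) (c : κ → ℝ) (x : Euc n) : ℝ :=
  ∑ j, (x j - x₀ j) * (x j - x₀ j) + ∑ a, (F a x - c a) * (F a x - c a)

/-- The regularized distance of `(x, F x)` from `(x₀, c)`. -/
noncomputable def regDist (F : κ → Euc n → ℝ) (x₀ : Euc n) (c : κ → ℝ) (τ : ℝ) (x : Euc n) : ℝ :=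
  √(sepSq F x₀ c x + τ ^ 2)

/-- The radial derivative of `defFun`. -/
noncomputable def radialSlope (x : Euc n) : ℝ := 2 * ‖x‖ * (5 - 2 * normSq x)

variable {F f : κ → Euc n → ℝ} {x₀ : Euc n} {c : κ → ℝ} {τ : ℝ}

lemma sepSq_nonneg (F : κ → Euc n → ℝ) (x₀ : Euc n) (c : κ → ℝ) (x : Euc n) :
    0 ≤ sepSq F x₀ c x := add_nonneg
  (Finset.sum_nonneg fun _ _ => mul_self_nonneg _) (Finset.sum_nonneg fun _ _ => mul_self_nonneg _)

lemma sq_regDist (F : κ → Euc n → ℝ) (x₀ : Euc n) (c : κ → ℝ) (τ : ℝ) (x : Euc n) :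
    regDist F x₀ c τ x ^ 2 = sepSq F x₀ c x + τ ^ 2 :=
  Real.sq_sqrt (add_nonneg (sepSq_nonneg _ _ _ _) (sq_nonneg τ))

lemma le_regDist (x : Euc n) : τ ≤ regDist F x₀ c τ x := by
  refine Real.le_sqrt_of_sq_le ?_
  linarith [sepSq_nonneg F x₀ c x]

lemma regDist_pos (hτ : 0 < τ) (x : Euc n) : 0 < regDist F x₀ c τ x := hτ.trans_le (le_regDist x)

lemma sqrt_sepSq_div_le (hτ : 0 < τ) (x : Euc n) :
    √(sepSq F x₀ c x) / regDist F x₀ c τ x ^ (n + 1) ≤ (regDist F x₀ c τ x ^ n)⁻¹ := by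
  have h := regDist_pos (F := F) (x₀ := x₀) (c := c) hτ x
  rw [div_le_iff₀ (by positivity), pow_succ, inv_mul_cancel_left₀ (by positivity)]
  exact Real.sqrt_le_sqrt (by nlinarith)

lemma defGrad_eq_radialSlope_mul {x : Euc n} (hx : x ≠ 0) (i : Fin (n + 1)) :
    defGrad i x = radialSlope x * unitVec x i := by
  have h : ‖x‖ ≠ 0 := norm_ne_zero_iff.2 hx
  simp only [defGrad, radialSlope, unitVec]
  field_simp

lemma abs_radialSlope_le {x : Euc n} (hx : x ∈ annulus n) : |radialSlope x| ≤ 12 := by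
  obtain ⟨h1, h2⟩ := hx
  rw [radialSlope, normSq_eq, abs_mul]
  have h3 : |2 * ‖x‖| ≤ 4 := by rw [abs_of_nonneg (by positivity)]; linarith
  have h4 : |5 - 2 * ‖x‖ ^ 2| ≤ 3 := abs_le.2 ⟨by nlinarith, by nlinarith⟩
  calc _ ≤ 4 * 3 := mul_le_mul h3 h4 (abs_nonneg _) (by norm_num)
    _ = 12 := by norm_num

lemma continuous_radialSlope : Continuous (radialSlope : Euc n → ℝ) := by
  have := (contDiff_normSq (n := n)).continuous
  unfold radialSlope
  fun_prop

lemma continuousOn_area_jac_mul_tangProj (hf : ∀ a, ContDiff ℝ 2 (f a)) :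
    ContinuousOn (fun x => area (jac f x * tangProj x)) (closedAnnulus n) := by
  refine continuous_area.comp_continuousOn (f := fun x => jac f x * tangProj x) ?_
  refine continuousOn_pi.2 fun a => continuousOn_pi.2 fun i => ?_
  simp only [Matrix.mul_apply]
  refine continuousOn_finsetSum _ fun k _ => ?_
  refine (contDiff_partialD (hf a) k).continuous.continuousOn.mul ?_
  have hu : ∀ i, ContinuousOn (fun x : Euc n => unitVec x i) (closedAnnulus n) := fun i => by
    have h1 : Continuous fun x : Euc n => x i := by fun_prop
    exact h1.continuousOn.div continuous_norm.continuousOn fun x hx =>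
      (zero_lt_one.trans_le hx.1).ne'
  exact continuousOn_const.sub ((hu k).mul (hu i))

namespace IsMinimal

lemma bddLipOn_sepSq (hF : IsMinimal F) : BddLipOn (closedAnnulus n) (sepSq F x₀ c) := by
  refine .add (.sum _ fun j => ?_) (.sum _ fun a => ?_)
  · have h : BddLipOn (closedAnnulus n) fun x : Euc n => x j - x₀ j :=
      .of_contDiff isCompact_closedAnnulus (by fun_prop)
    exact h.mul h
  · have h := (hF.bddLipOn a).sub (.const (c a))
    exact h.mul h

lemma bddLipOn_regDist (hF : IsMinimal F) (hτ : 0 < τ) :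
    BddLipOn (closedAnnulus n) (regDist F x₀ c τ) :=
  (hF.bddLipOn_sepSq.add (.const (τ ^ 2))).sqrt (pow_pos hτ 2)
    fun x _ => by linarith [sepSq_nonneg F x₀ c x]

lemma bddLipOn_inv_regDist_pow (hF : IsMinimal F) (hτ : 0 < τ) (k : ℕ) :
    BddLipOn (closedAnnulus n) fun x => (regDist F x₀ c τ x ^ k)⁻¹ :=
  ((hF.bddLipOn_regDist hτ).pow k).inv (pow_pos hτ k)
    fun x _ => pow_le_pow_left₀ hτ.le (le_regDist x) k

lemma measurable_regDist (hF : IsMinimal F) : Measurable (regDist F x₀ c τ) := by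
  obtain ⟨K, hK⟩ := hF.lipschitz
  have h : ∀ a, Continuous (F a) := fun a => (hK a).continuous
  have : Continuous (regDist F x₀ c τ) := by
    unfold regDist sepSq
    fun_prop
  exact this.measurable

lemma hasPartialAt_inv_regDist_pow (hτ : 0 < τ) {x : Euc n} (hx : ∀ a, DifferentiableAt ℝ (F a) x)
    (i : Fin (n + 1)) (k : ℕ) :
    HasPartialAt i (fun x => (regDist F x₀ c τ x ^ k)⁻¹)
      (-(k * (regDist F x₀ c τ x ^ (k + 2))⁻¹ *
        ((x i - x₀ i) + ∑ a, partialD i (F a) x * (F a x - c a)))) x := by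
  have hρ := regDist_pos (F := F) (x₀ := x₀) (c := c) hτ x
  have hj : ∀ j, HasPartialAt i (fun x : Euc n => x j - x₀ j) (if j = i then 1 else 0) x := fun j =>
    ((HasPartialAt.coord j).sub (.const (x₀ j))).congr_value (sub_zero _)
  have ha : ∀ a, HasPartialAt i (fun x : Euc n => F a x - c a) (partialD i (F a) x) x := fun a =>
    ((HasPartialAt.of_differentiableAt (hx a)).sub (.const (c a))).congr_value (sub_zero _)
  have hs : HasPartialAt i (fun x => sepSq F x₀ c x + τ ^ 2)
      (2 * ((x i - x₀ i) + ∑ a, partialD i (F a) x * (F a x - c a))) x := by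
    refine (((HasPartialAt.sum _ fun j _ => (hj j).mul (hj j)).add
      (HasPartialAt.sum _ fun a _ => (ha a).mul (ha a))).add (.const (τ ^ 2))).congr_value ?_
    rw [add_zero, mul_add, Finset.mul_sum]
    congr 1
    · rw [Finset.sum_eq_single i (fun j _ h => by simp [h]) (by simp)]
      simp
      ring
    · exact Finset.sum_congr rfl fun a _ => by ring
  have hpos : sepSq F x₀ c x + τ ^ 2 ≠ 0 := by
    rw [← sq_regDist]
    positivity
  refine (((hs.sqrt hpos).pow k).inv (by change regDist F x₀ c τ x ^ k ≠ 0; positivity)).congr_value ?_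
  change -((regDist F x₀ c τ x ^ k) ^ 2)⁻¹ * (k * regDist F x₀ c τ x ^ (k - 1) *
    (1 / (2 * regDist F x₀ c τ x) * _)) = _
  rcases k with _ | k
  · simp
  · rw [Nat.add_sub_cancel]
    field_simp
    ring

lemma integrableOn_area_div (hF : IsMinimal F) (hτ : 0 < τ) :
    IntegrableOn (fun x => area (jac F x) * (τ ^ 2 / regDist F x₀ c τ x ^ (n + 3))) (annulus n) := by
  obtain ⟨C, hC0, -, hC⟩ := hF.exists_bounds
  refine integrableOn_annulus_of_bound (C := C * (τ ^ 2 / τ ^ (n + 3))) ((measurable_area_jac F).mul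
    (measurable_const.div (hF.measurable_regDist.pow_const _))).aestronglyMeasurable fun x _ => ?_
  have hρ := regDist_pos (F := F) (x₀ := x₀) (c := c) hτ x
  have hA := zero_le_one.trans (one_le_area (jac F x))
  rw [abs_of_nonneg (by positivity)]
  refine mul_le_mul (hC x).2.2 ?_ (by positivity) hC0
  gcongr
  exact le_regDist x

lemma exists_area_tang_le (hF : IsMinimal F) (hf : ∀ a, ContDiff ℝ 2 (f a)) :
    ∃ C, 0 ≤ C ∧ ∀ᵐ x, x ∈ annulus n → area (jac F x * tangProj x) ≤
      area (jac f x * tangProj x) + 1 + C * tangEnergy (fun a x => F a x - f a x) x := by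
  obtain ⟨B, hB0, -, hB⟩ := hF.exists_bounds
  choose H hH0 hH using fun a => (BddLipOn.of_contDiff isCompact_closedAnnulus
    ((hf a).of_le (by norm_num) : ContDiff ℝ 1 (f a))).exists_bound_partialD
  have hH' : ∀ x ∈ annulus n, ∀ a i, |partialD i (f a) x| ≤ B + ∑ b, H b := fun x hx a i =>
    (hH a x hx i).trans ((Finset.single_le_sum (fun b _ => hH0 b) (Finset.mem_univ a)).trans
      (by linarith))
  have hB' : ∀ x, ∀ a i, |partialD i (F a) x| ≤ B + ∑ b, H b := fun x a i =>
    ((hB x).1 a i).trans (by linarith [Finset.sum_nonneg fun b (_ : b ∈ Finset.univ) => hH0 b])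
  obtain ⟨C, hC0, hC⟩ := exists_area_le_add_sq κ (Fin (n + 1)) ((n + 1) * (B + ∑ b, H b))
  refine ⟨C, hC0, ?_⟩
  filter_upwards [hF.ae_differentiableAt] with x hdiff hx
  have hx0 := ne_zero_of_mem_annulus hx
  refine (hC (fun a i => (jac F x * tangProj x) a i) (abs_jac_mul_tangProj_le hx0 (hB' x))
    (fun a i => (jac f x * tangProj x) a i) (abs_jac_mul_tangProj_le hx0 (hH' x hx))).trans_eq ?_
  have hG : jac (fun a x => F a x - f a x) x = jac F x - jac f x := by
    ext a i
    exact ((HasPartialAt.of_differentiableAt (hdiff a)).sub (.of_differentiableAt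
      ((hf a).differentiable (by simp) x))).partialD_eq
  rw [tangEnergy, hG, Matrix.sub_mul]
  rfl

/-- The monotonicity inequality with a cutoff at the boundary. -/
lemma integral_cutoff_area_le (hF : IsMinimal F) (hf : ∀ a, ContDiff ℝ 2 (f a)) (hτ : 0 < τ)
    (x₀ : Euc n) (c : κ → ℝ) : ∃ K, ∀ ε, 0 < ε →
    ∫ x in annulus n, defFun x * (defFun x + ε)⁻¹ *
      ((n + 1 : ℕ) * (area (jac F x) * (τ ^ 2 / regDist F x₀ c τ x ^ (n + 3)))) ≤
    (∫ x in annulus n, ε / (defFun x + ε) ^ 2 * (|radialSlope x| *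
      (area (jac f x * tangProj x) + 1) * (√(sepSq F x₀ c x) / regDist F x₀ c τ x ^ (n + 1)))) +
    K * ∫ x in annulus n, ε / (defFun x + ε) ^ 2 * tangEnergy (fun a x => F a x - f a x) x := by
  obtain ⟨C, hC0, hC⟩ := hF.exists_area_tang_le hf
  refine ⟨12 * C * (τ ^ n)⁻¹, fun ε hε => ?_⟩
  set ρ := regDist F x₀ c τ with hρ
  have hρ0 : ∀ x, 0 < ρ x := regDist_pos hτ
  set ζ : Euc n → ℝ := fun x => defFun x * (defFun x + ε)⁻¹ with hζ
  have hζt : IsTest ζ := isTest_defFun.mul (bddLipOn_inv_defFun hε)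
  have hζψ : IsTest fun x => ζ x * (ρ x ^ (n + 1))⁻¹ := hζt.mul (hF.bddLipOn_inv_regDist_pow hτ _)
  have hΦ : ∀ j, IsTest fun x => ζ x * (ρ x ^ (n + 1))⁻¹ * (x j - x₀ j) := fun j =>
    hζψ.mul (.of_contDiff isCompact_closedAnnulus (by fun_prop))
  have hΨ : ∀ a, IsTest fun x => ζ x * (ρ x ^ (n + 1))⁻¹ * (F a x - c a) := fun a =>
    hζψ.mul ((hF.bddLipOn a).sub (.const _))
  obtain ⟨hint, h0⟩ := hF.stationary hΦ hΨ
  have hpcont : ContinuousOn (fun x : Euc n => ε / (defFun x + ε) ^ 2) (closedAnnulus n) :=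
    continuousOn_const.div ((contDiff_defFun.continuous.continuousOn.add continuousOn_const).pow 2)
      fun x hx => (pow_pos (by linarith [defFun_nonneg hx]) 2).ne'
  have hcont : ContinuousOn (fun x => ε / (defFun x + ε) ^ 2 * (|radialSlope x| *
      (area (jac f x * tangProj x) + 1) * (√(sepSq F x₀ c x) / ρ x ^ (n + 1))))
      (closedAnnulus n) :=
    hpcont.mul ((continuous_radialSlope.abs.continuousOn.mul
      ((continuousOn_area_jac_mul_tangProj hf).add continuousOn_const)).mul
      (hF.bddLipOn_sepSq.continuousOn.sqrt.mul (hF.bddLipOn_inv_regDist_pow hτ (n + 1)).continuousOn))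
  have hi1 := integrableOn_annulus_of_continuousOn hcont
  have hi2 := hF.integrableOn_mul_tangEnergy hf hpcont
  have hi3 := (hF.integrableOn_area_div (x₀ := x₀) (c := c) hτ).const_mul ((n + 1 : ℕ) : ℝ)
  rw [← integral_const_mul]
  have hsum := integral_add (hint.add hi1) (hi2.const_mul (12 * C * (τ ^ n)⁻¹))
  simp only [Pi.add_apply] at hsum
  rw [integral_add hint hi1, h0, zero_add] at hsum
  rw [← hsum]
  refine integral_mono_ae ?_ ((hint.add hi1).add (hi2.const_mul _)) ?_
  · refine hi3.bdd_mul (c := 1) (f := ζ) ?_ ?_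
    · exact (contDiff_defFun.continuous.measurable.mul
        (contDiff_defFun.continuous.measurable.add_const ε).inv).aestronglyMeasurable
    · refine (ae_restrict_iff' measurableSet_annulus).2 (ae_of_all _ fun x hx => ?_)
      have := defFun_pos hx
      change ‖defFun x * (defFun x + ε)⁻¹‖ ≤ 1
      rw [Real.norm_of_nonneg (by positivity), ← div_eq_mul_inv]
      exact div_le_one_of_le₀ (by linarith) (by positivity)
  refine (ae_restrict_iff' measurableSet_annulus).2 ?_
  filter_upwards [hF.ae_differentiableAt, hC] with x hdiff hCx hx
  have hω := defFun_pos hx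
  have hx0 := ne_zero_of_mem_annulus hx
  have hρx := hρ0 x
  set p := ε / (defFun x + ε) ^ 2 with hp
  have hp0 : 0 ≤ p := by positivity
  have hζd : ∀ i, HasPartialAt i ζ (p * defGrad i x) x := fun i => by
    refine ((hasPartialAt_defFun i x).mul
      (((hasPartialAt_defFun i x).add (.const ε)).inv (by positivity))).congr_value ?_
    rw [hp]
    field_simp
    ring
  set w : Fin (n + 1) → ℝ := fun i => (x i - x₀ i) + ∑ a, partialD i (F a) x * (F a x - c a) with hw
  set q : Fin (n + 1) → ℝ := fun i => p * radialSlope x * (ρ x ^ (n + 1))⁻¹ * unitVec x i -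
    ζ x * (n + 1 : ℕ) * (ρ x ^ (n + 1 + 2))⁻¹ * w i with hq
  have hζψd : ∀ i, HasPartialAt i (fun x => ζ x * (ρ x ^ (n + 1))⁻¹) (q i) x := fun i => by
    refine ((hζd i).mul (hasPartialAt_inv_regDist_pow hτ hdiff i (n + 1))).congr_value ?_
    rw [defGrad_eq_radialSlope_mul hx0]
    simp only [hq, hw, ← hρ]
    ring
  have hΦd : ∀ i j, HasPartialAt i (fun x => ζ x * (ρ x ^ (n + 1))⁻¹ * (x j - x₀ j))
      (q i * (x j - x₀ j) + ζ x * (ρ x ^ (n + 1))⁻¹ * if j = i then 1 else 0) x := fun i j =>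
    ((hζψd i).mul ((HasPartialAt.coord j).sub (.const (x₀ j)))).congr_value (by rw [sub_zero])
  have hΨd : ∀ i a, HasPartialAt i (fun x => ζ x * (ρ x ^ (n + 1))⁻¹ * (F a x - c a))
      (q i * (F a x - c a) + ζ x * (ρ x ^ (n + 1))⁻¹ * jac F x a i) x := fun i a =>
    ((hζψd i).mul ((HasPartialAt.of_differentiableAt (hdiff a)).sub (.const (c a)))).congr_value
      (by rw [sub_zero]; rfl)
  have hmain := monotonicity_integrand_le (jac F x) (fun j => x j - x₀ j) (unitVec x)
    (fun a => F a x - c a) (unitVec_dotProduct_self hx0) (l := radialSlope x) hp0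
    (show 0 ≤ ζ x by simp only [hζ]; positivity) hρx (sq_regDist F x₀ c τ x) (q := q)
    (Fintype.card_fin (n + 1)) (fun i => rfl)
  simp only [(hΦd _ _).partialD_eq, (hΨd _ _).partialD_eq]
  refine hmain.trans ?_
  rw [add_assoc]
  refine add_le_add le_rfl ?_
  change p * (|radialSlope x| * area (jac F x * tangProj x) * (√(sepSq F x₀ c x) / ρ x ^ (n + 1))) ≤ _
  have h1 := sqrt_sepSq_div_le (F := F) (x₀ := x₀) (c := c) hτ x
  have h2 : (ρ x ^ n)⁻¹ ≤ (τ ^ n)⁻¹ :=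
    inv_anti₀ (pow_pos hτ n) (pow_le_pow_left₀ hτ.le (le_regDist x) n)
  set Q := √(sepSq F x₀ c x) / ρ x ^ (n + 1) with hQ
  have hQ0 : 0 ≤ Q := by positivity
  have h3 : |radialSlope x| * Q ≤ 12 * (τ ^ n)⁻¹ :=
    mul_le_mul (abs_radialSlope_le hx) (h1.trans h2) hQ0 (by norm_num)
  have hE := tangEnergy_nonneg (fun a x => F a x - f a x) x
  set E := tangEnergy (fun a x => F a x - f a x) x
  have h4 := mul_le_mul_of_nonneg_left (hCx hx) (show 0 ≤ p * (|radialSlope x| * Q) by positivity)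
  have h5 := mul_le_mul_of_nonneg_right h3 (show 0 ≤ p * (C * E) by positivity)
  linarith

/-- The monotonicity inequality: a bound for the area by a boundary integral that only
sees the tangential derivatives of the boundary data. -/
theorem integral_area_le (hF : IsMinimal F) (hf : ∀ a, ContDiff ℝ 2 (f a))
    (hFf : ∀ a x, ‖x‖ = 1 ∨ ‖x‖ = 2 → F a x = f a x) (hτ : 0 < τ) {C : ℝ} (hC0 : 0 ≤ C)
    (hC : ∀ ε, 0 < ε → ∫ x in annulus n, ε / (defFun x + ε) ^ 2 * ∑ i, defGrad i x ^ 2 ≤ C)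
    {b : ℝ} (hb0 : 0 ≤ b) (hb : ∀ x, ‖x‖ = 1 ∨ ‖x‖ = 2 → |radialSlope x| *
      (area (jac f x * tangProj x) + 1) * (√(sepSq F x₀ c x) / regDist F x₀ c τ x ^ (n + 1)) ≤
        b * ∑ i, defGrad i x ^ 2) :
    (n + 1 : ℕ) * ∫ x in annulus n, area (jac F x) * (τ ^ 2 / regDist F x₀ c τ x ^ (n + 3)) ≤
      b * C := by
  obtain ⟨K, hK⟩ := hF.integral_cutoff_area_le hf hτ x₀ c
  have hcont : ContinuousOn (fun x => |radialSlope x| * (area (jac f x * tangProj x) + 1) *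
      (√(sepSq F x₀ c x) / regDist F x₀ c τ x ^ (n + 1))) (closedAnnulus n) :=
    (continuous_radialSlope.abs.continuousOn.mul
      ((continuousOn_area_jac_mul_tangProj hf).add continuousOn_const)).mul
      (hF.bddLipOn_sepSq.continuousOn.sqrt.mul (hF.bddLipOn_inv_regDist_pow hτ (n + 1)).continuousOn)
  set ε : ℕ → ℝ := fun k => 1 / ((k : ℝ) + 1) with hε
  have hεpos : ∀ k, 0 < ε k := fun k => by simp only [hε]; positivity
  have hε0 : Tendsto ε atTop (𝓝 0) := tendsto_one_div_add_atTop_nhds_zero_nat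
  have hE := hF.tendsto_layer_tangEnergy hf hFf hεpos hε0
  have hi := (hF.integrableOn_area_div (x₀ := x₀) (c := c) hτ).const_mul ((n + 1 : ℕ) : ℝ)
  have hL : Tendsto (fun k => ∫ x in annulus n, defFun x * (defFun x + ε k)⁻¹ *
      ((n + 1 : ℕ) * (area (jac F x) * (τ ^ 2 / regDist F x₀ c τ x ^ (n + 3))))) atTop
      (𝓝 (∫ x in annulus n,
        (n + 1 : ℕ) * (area (jac F x) * (τ ^ 2 / regDist F x₀ c τ x ^ (n + 3))))) := by
    have hωm : Measurable (defFun : Euc n → ℝ) := contDiff_defFun.continuous.measurable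
    refine tendsto_integral_of_dominated_convergence _ (fun k => ?_) hi.norm (fun k => ?_) ?_
    · exact (hωm.mul (hωm.add_const _).inv).aestronglyMeasurable.mul hi.aestronglyMeasurable
    · refine (ae_restrict_iff' measurableSet_annulus).2 (ae_of_all _ fun x hx => ?_)
      have h1 := defFun_pos hx
      have h2 := hεpos k
      rw [norm_mul, Real.norm_of_nonneg (r := defFun x * _) (by positivity), ← div_eq_mul_inv]
      exact mul_le_of_le_one_left (norm_nonneg _) (div_le_one_of_le₀ (by linarith) (by positivity))
    · refine (ae_restrict_iff' measurableSet_annulus).2 (ae_of_all _ fun x hx => ?_)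
      have h1 := (defFun_pos hx).ne'
      have h2 : Tendsto (fun k => defFun x * (defFun x + ε k)⁻¹) atTop
          (𝓝 (defFun x * (defFun x + 0)⁻¹)) :=
        tendsto_const_nhds.mul ((tendsto_const_nhds.add hε0).inv₀ (by simpa using h1))
      rw [add_zero, mul_inv_cancel₀ h1] at h2
      simpa only [one_mul] using h2.mul_const
        ((n + 1 : ℕ) * (area (jac F x) * (τ ^ 2 / regDist F x₀ c τ x ^ (n + 3))))
  rw [← integral_const_mul]
  refine le_of_forall_pos_le_add fun η hη => ?_
  obtain ⟨ε₀, hε₀, hlayer⟩ := exists_layer_integral_le hC0 hC hcont hb0 hb hη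
  have hR : Tendsto (fun k => b * C + η + K * ∫ x in annulus n, ε k / (defFun x + ε k) ^ 2 *
      tangEnergy (fun a x => F a x - f a x) x) atTop (𝓝 (b * C + η + K * 0)) :=
    tendsto_const_nhds.add (tendsto_const_nhds.mul hE)
  rw [mul_zero, add_zero] at hR
  refine le_of_tendsto_of_tendsto hL hR ?_
  filter_upwards [hε0.eventually (ge_mem_nhds hε₀)] with k hk
  exact (hK (ε k) (hεpos k)).trans (add_le_add (hlayer (ε k) (hεpos k) hk) le_rfl)

end IsMinimal

end Monotonicity

section Density

open scoped NNReal
open Filter Topology Set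

variable {n : ℕ} {κ : Type*} [Fintype κ]

open scoped MatrixOrder in
lemma exists_graphMetric_eq_transpose_mul {ι : Type*} [Fintype ι] [DecidableEq ι] (D : Matrix κ ι ℝ) :
    ∃ B : Matrix ι ι ℝ, graphMetric D = B.transpose * B := by
  have h : (graphMetric D).PosSemidef := by
    refine Matrix.PosSemidef.one.add ?_
    simpa using Matrix.posSemidef_conjTranspose_mul_self D
  obtain ⟨B, hB⟩ := CStarAlgebra.nonneg_iff_eq_star_mul_self.mp h.nonneg
  exact ⟨B, by rw [hB, Matrix.star_eq_conjTranspose, Matrix.conjTranspose_eq_transpose_of_trivial]⟩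

/-- The set where the affine approximation of a graph with slope `D` at `x₀` stays within distance
`τ` of its base point. -/
def ellipsoid (D : Matrix κ (Fin (n + 1)) ℝ) (x₀ : Euc n) (τ : ℝ) : Set (Euc n) :=
  {x | ∑ i, (x i - x₀ i) ^ 2 + ∑ a, (∑ i, D a i * (x i - x₀ i)) ^ 2 ≤ τ ^ 2}

lemma isClosed_ellipsoid (D : Matrix κ (Fin (n + 1)) ℝ) (x₀ : Euc n) (τ : ℝ) :
    IsClosed (ellipsoid D x₀ τ) := by
  refine isClosed_le ?_ continuous_const
  fun_prop

lemma ellipsoid_subset_closedBall (D : Matrix κ (Fin (n + 1)) ℝ) (x₀ : Euc n) {τ : ℝ} (hτ : 0 ≤ τ) :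
    ellipsoid D x₀ τ ⊆ Metric.closedBall x₀ τ := by
  intro x hx
  have h : ∑ i, (x i - x₀ i) ^ 2 ≤ τ ^ 2 := le_trans
    (le_add_of_nonneg_right (Finset.sum_nonneg fun _ _ => sq_nonneg _)) hx
  rw [Metric.mem_closedBall, EuclideanSpace.dist_eq, Real.sqrt_le_left hτ]
  simpa [Real.dist_eq, sq_abs] using h

lemma volume_ellipsoid_mul_area (D : Matrix κ (Fin (n + 1)) ℝ) (x₀ : Euc n) {τ : ℝ} (hτ : 0 ≤ τ) :
    volume.real (ellipsoid D x₀ τ) * area D =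
      τ ^ (n + 1) * volume.real (Metric.ball (0 : Euc n) 1) := by
  obtain ⟨B, hB⟩ := exists_graphMetric_eq_transpose_mul D
  have hdet : (graphMetric D).det = B.det ^ 2 := by
    rw [hB, Matrix.det_mul, Matrix.det_transpose, sq]
  have hB0 : B.det ≠ 0 := by
    intro h
    have := one_le_det_graphMetric D
    rw [hdet, h] at this
    norm_num at this
  have harea : area D = |B.det| := by rw [area, hdet, Real.sqrt_sq_eq_abs]
  have hL : LinearMap.det (Matrix.toEuclideanLin B) = B.det := by
    rw [Matrix.toEuclideanLin_eq_toLin_orthonormal, LinearMap.det_toLin]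
  have hset : ellipsoid D x₀ τ = (fun x => x + (-x₀)) ⁻¹'
      (Matrix.toEuclideanLin B ⁻¹' Metric.closedBall 0 τ) := by
    ext x
    simp only [ellipsoid, mem_ofPred_eq, mem_preimage, Metric.mem_closedBall, dist_zero_right]
    rw [EuclideanSpace.norm_eq, Real.sqrt_le_left hτ]
    have key : ∀ v : Fin (n + 1) → ℝ, ∑ i, v i ^ 2 + ∑ a, (∑ i, D a i * v i) ^ 2 =
        ∑ i, (B.mulVec v i) ^ 2 := by
      intro v
      have h := congrArg (fun M => v ⬝ᵥ M.mulVec v) hB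
      simp only [graphMetric, Matrix.add_mulVec, Matrix.one_mulVec, ← Matrix.mulVec_mulVec,
        dotProduct_add] at h
      rw [Matrix.dotProduct_mulVec _ D.transpose, Matrix.dotProduct_mulVec _ B.transpose,
        Matrix.vecMul_transpose, Matrix.vecMul_transpose] at h
      simpa [dotProduct, Matrix.mulVec, sq] using h
    have := key (fun i => x i - x₀ i)
    rw [this]
    simp [Matrix.toLpLin_apply, Matrix.mulVec, dotProduct, sub_eq_add_neg]
  rw [harea, hset, Measure.real, measure_preimage_add_right,
    Measure.addHaar_preimage_linearMap _ (by rwa [hL]), hL, ENNReal.toReal_mul,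
    ENNReal.toReal_ofReal (abs_nonneg _), ← Measure.real, Measure.addHaar_real_closedBall _ _ hτ]
  rw [abs_inv]
  have := abs_ne_zero.2 hB0
  simp
  field_simp

lemma fderiv_apply_eq_sum (f : Euc n → ℝ) (x v : Euc n) :
    fderiv ℝ f x v = ∑ i, partialD i f x * v i := by
  conv_lhs => rw [← (EuclideanSpace.basisFun (Fin (n + 1)) ℝ).sum_repr v, map_sum]
  simp [partialD, mul_comm]

lemma sepSq_le_of_mem_ellipsoid {F : κ → Euc n → ℝ} {x₀ x : Euc n} {τ : ℝ} (hτ : 0 ≤ τ)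
    (hx : x ∈ ellipsoid (jac F x₀) x₀ τ)
    (hFx : ∀ a, ‖F a x - F a x₀ - fderiv ℝ (F a) x₀ (x - x₀)‖ ≤
      1 / ((Fintype.card κ : ℝ) + 1) * ‖x - x₀‖) :
    sepSq F x₀ (fun a => F a x₀) x ≤ 3 * τ ^ 2 := by
  have hball := ellipsoid_subset_closedBall (jac F x₀) x₀ hτ hx
  rw [Metric.mem_closedBall, dist_eq_norm] at hball
  set k : ℝ := (Fintype.card κ : ℝ) with hk
  have hk0 : 0 ≤ k := Nat.cast_nonneg _
  have hterm : ∀ a, (F a x - F a x₀) * (F a x - F a x₀) ≤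
      2 * (∑ i, jac F x₀ a i * (x i - x₀ i)) ^ 2 + 2 * (1 / (k + 1) * τ) ^ 2 := by
    intro a
    have h := hFx a
    rw [fderiv_apply_eq_sum, Real.norm_eq_abs] at h
    have h2 : |F a x - F a x₀ - ∑ i, partialD i (F a) x₀ * (x - x₀) i| ≤ 1 / (k + 1) * τ :=
      h.trans (by gcongr)
    have h3 := sq_le_sq' (abs_le.1 h2).1 (abs_le.1 h2).2
    simp only [PiLp.sub_apply] at h3
    simp only [jac, Matrix.of_apply]
    nlinarith [sq_nonneg (F a x - F a x₀ - 2 * ∑ i, partialD i (F a) x₀ * (x i - x₀ i))]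
  have hsum := Finset.sum_le_sum fun a (_ : a ∈ Finset.univ) => hterm a
  rw [Finset.sum_add_distrib, ← Finset.mul_sum, Finset.sum_const, Finset.card_univ, nsmul_eq_mul,
    ← hk] at hsum
  have hη : k * (2 * (1 / (k + 1) * τ) ^ 2) ≤ τ ^ 2 := by
    have : k * (2 * (1 / (k + 1) * τ) ^ 2) = 2 * k / (k + 1) ^ 2 * τ ^ 2 := by
      field_simp
    rw [this]
    refine mul_le_of_le_one_left (sq_nonneg τ) ((div_le_one (by positivity)).2 ?_)
    nlinarith
  have hE : ∑ i, (x i - x₀ i) ^ 2 + ∑ a, (∑ i, jac F x₀ a i * (x i - x₀ i)) ^ 2 ≤ τ ^ 2 := hx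
  have h0 : 0 ≤ ∑ i, (x i - x₀ i) ^ 2 := Finset.sum_nonneg fun _ _ => sq_nonneg _
  simp only [sepSq, ← sq (_ - x₀ _)]
  linarith

/-- Weighted area of a minimal graph concentrates near almost every point. -/
theorem IsMinimal.ae_le_integral_area {F : κ → Euc n → ℝ} (hF : IsMinimal F) :
    ∀ᵐ x₀ : Euc n, x₀ ∈ annulus n → ∃ τ > 0,
      volume.real (Metric.ball (0 : Euc n) 1) / 2 ^ (n + 4) ≤
        ∫ x in annulus n, area (jac F x) *
          (τ ^ 2 / regDist F x₀ (fun a => F a x₀) τ x ^ (n + 3)) := by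
  obtain ⟨C, hC0, -, hC⟩ := hF.exists_bounds
  set g : Euc n → ℝ := fun x => area (jac F x) with hg
  set v := volume.real (Metric.ball (0 : Euc n) 1) with hv
  have hv0 : 0 < v := ENNReal.toReal_pos (Metric.measure_ball_pos _ _ one_pos).ne'
    measure_ball_lt_top.ne
  have hg1 : ∀ x, 1 ≤ g x := fun x => one_le_area _
  have hgi : LocallyIntegrable g := (locallyIntegrable_const C).mono
    (measurable_area_jac F).aestronglyMeasurable (ae_of_all _ fun x => by
      rw [Real.norm_of_nonneg (zero_le_one.trans (hg1 x)), Real.norm_of_nonneg hC0]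
      exact (hC x).2.2)
  filter_upwards [(Besicovitch.vitaliFamily volume).ae_tendsto_average_norm_sub hgi,
    hF.ae_differentiableAt] with x₀ hLeb hdiff hx₀
  have hLeb' := hLeb.comp (Besicovitch.tendsto_filterAt volume x₀)
  have e1 := hLeb'.eventually (gt_mem_nhds (show (0 : ℝ) < 1 / 2 by norm_num))
  have e2 : ∀ᶠ y in 𝓝 x₀, y ∈ annulus n ∧ ∀ a, ‖F a y - F a x₀ - fderiv ℝ (F a) x₀ (y - x₀)‖ ≤
      1 / ((Fintype.card κ : ℝ) + 1) * ‖y - x₀‖ :=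
    Filter.Eventually.and (isOpen_annulus.mem_nhds hx₀) (eventually_all.2 fun a =>
      (hdiff a).hasFDerivAt.isLittleO.bound (by positivity))
  obtain ⟨r, hr0, hr⟩ := Metric.nhds_basis_closedBall.eventually_iff.1 e2
  obtain ⟨τ, hτ, hτ0, hτr⟩ := (e1.and (Ioc_mem_nhdsGT hr0)).exists
  refine ⟨τ, hτ0, ?_⟩
  have hsub : Metric.closedBall x₀ τ ⊆ Metric.closedBall x₀ r := Metric.closedBall_subset_closedBall hτr
  set E := ellipsoid (jac F x₀) x₀ τ with hE
  have hEB : E ⊆ Metric.closedBall x₀ τ := ellipsoid_subset_closedBall _ _ hτ0.le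
  have hEm : MeasurableSet E := (isClosed_ellipsoid _ _ _).measurableSet
  have hEfin : volume E < ⊤ := (measure_mono hEB).trans_lt measure_closedBall_lt_top
  have hgB : IntegrableOn g (Metric.closedBall x₀ τ) :=
    hgi.integrableOn_isCompact (isCompact_closedBall _ _)
  have hgB' : IntegrableOn (fun x => ‖g x - g x₀‖) (Metric.closedBall x₀ τ) :=
    (hgB.sub (integrableOn_const measure_closedBall_lt_top.ne)).norm
  have hballvol : volume.real (Metric.closedBall x₀ τ) = τ ^ (n + 1) * v := by
    rw [Measure.addHaar_real_closedBall _ _ hτ0.le]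
    simp [hv]
  have hosc : ∫ x in Metric.closedBall x₀ τ, ‖g x - g x₀‖ ≤ τ ^ (n + 1) * v / 2 := by
    simp only [Function.comp_apply, setAverage_eq, smul_eq_mul, hballvol] at hτ
    rw [inv_mul_lt_iff₀ (by positivity)] at hτ
    linarith
  have hEg : τ ^ (n + 1) * v / 2 ≤ ∫ x in E, g x := by
    have h1 : ∫ x in E, ‖g x - g x₀‖ ≤ τ ^ (n + 1) * v / 2 := (setIntegral_mono_set hgB'
      (ae_of_all _ fun _ => norm_nonneg _) hEB.eventuallyLE).trans hosc
    have h2 : ∫ x in E, (g x₀ - ‖g x - g x₀‖) ≤ ∫ x in E, g x := by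
      refine setIntegral_mono ((integrableOn_const hEfin.ne).sub (hgB'.mono_set hEB))
        (hgB.mono_set hEB) fun x => ?_
      have := neg_abs_le (g x - g x₀)
      simp only [Real.norm_eq_abs]
      linarith
    rw [integral_sub (f := fun _ => g x₀) (integrableOn_const hEfin.ne) (hgB'.mono_set hEB),
      setIntegral_const, smul_eq_mul] at h2
    have h3 : volume.real E * g x₀ = τ ^ (n + 1) * v := volume_ellipsoid_mul_area _ _ hτ0.le
    linarith
  have hint := hF.integrableOn_area_div (x₀ := x₀) (c := fun a => F a x₀) hτ0
  have hEA : E ⊆ annulus n := fun x hx => (hr (hsub (hEB hx))).1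
  have hnn : ∀ x, 0 ≤ g x * (τ ^ 2 / regDist F x₀ (fun a => F a x₀) τ x ^ (n + 3)) := fun x =>
    mul_nonneg (zero_le_one.trans (hg1 x))
      (div_nonneg (sq_nonneg τ) (pow_nonneg (regDist_pos hτ0 x).le _))
  have hlow : ∫ x in E, g x * (τ ^ 2 / (2 * τ) ^ (n + 3)) ≤
      ∫ x in E, g x * (τ ^ 2 / regDist F x₀ (fun a => F a x₀) τ x ^ (n + 3)) := by
    refine setIntegral_mono_on ((hgB.mono_set hEB).mul_const _) (hint.mono_set hEA) hEm
      fun x hx => ?_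
    have hsep := sepSq_le_of_mem_ellipsoid hτ0.le hx (hr (hsub (hEB hx))).2
    have hreg : regDist F x₀ (fun a => F a x₀) τ x ≤ 2 * τ := by
      refine Real.sqrt_le_iff.2 ⟨by linarith, ?_⟩
      linarith
    have hp := regDist_pos (F := F) (x₀ := x₀) (c := fun a => F a x₀) hτ0 x
    have := zero_le_one.trans (hg1 x)
    gcongr
  calc v / 2 ^ (n + 4) = τ ^ (n + 1) * v / 2 * (τ ^ 2 / (2 * τ) ^ (n + 3)) := by
        rw [mul_pow]
        field_simp
        ring
    _ ≤ (∫ x in E, g x) * (τ ^ 2 / (2 * τ) ^ (n + 3)) := by gcongr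
    _ = ∫ x in E, g x * (τ ^ 2 / (2 * τ) ^ (n + 3)) := (integral_mul_const _ _).symm
    _ ≤ _ := hlow
    _ ≤ _ := setIntegral_mono_set hint (ae_of_all _ hnn) hEA.eventuallyLE

end Density

section Obstruction

open Filter Topology Set

variable {n : ℕ} {κ : Type*} [Fintype κ]

lemma partialD_const_mul {f : Euc n → ℝ} (hf : Differentiable ℝ f) (r : ℝ) (i : Fin (n + 1))
    (x : Euc n) : partialD i (fun y => r * f y) x = r * partialD i f x := by
  simp [partialD, fderiv_const_mul (hf x)]

lemma exists_tangential_jac_bound {f : κ → Euc n → ℝ} (hf : ∀ a, ContDiff ℝ 2 (f a)) :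
    ∃ c : ℝ, 0 ≤ c ∧ ∀ x, ‖x‖ = 1 ∨ ‖x‖ = 2 → ∑ a, ∑ i, (jac f x * tangProj x) a i ^ 2 ≤ c := by
  have hK : ∀ a i, ∃ K, ∀ x ∈ closedAnnulus n, |partialD i (f a) x| ≤ K := fun a i =>
    isCompact_closedAnnulus.exists_bound_of_continuousOn
      (contDiff_partialD (hf a) i).continuous.continuousOn
  choose K hK using hK
  refine ⟨∑ _a : κ, ∑ _i : Fin (n + 1), ((n + 1) * ∑ a, ∑ i, |K a i|) ^ 2, by positivity,
    fun x hx => Finset.sum_le_sum fun a _ => Finset.sum_le_sum fun i _ => ?_⟩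
  have hx0 : x ≠ 0 := by
    rintro rfl
    rcases hx with h | h <;> norm_num at h
  have hxA : x ∈ closedAnnulus n := by
    rcases hx with h | h <;> constructor <;> norm_num [h]
  rw [← sq_abs]
  refine pow_le_pow_left₀ (abs_nonneg _) (abs_jac_mul_tangProj_le hx0 (fun a i => ?_) a i) 2
  calc |partialD i (f a) x| ≤ |K a i| := (hK a i x hxA).trans (le_abs_self _)
    _ ≤ ∑ i, |K a i| :=
      Finset.single_le_sum (f := fun i => |K a i|) (fun _ _ => abs_nonneg _) (Finset.mem_univ i)
    _ ≤ _ := Finset.single_le_sum (f := fun a => ∑ i, |K a i|)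
      (fun _ _ => Finset.sum_nonneg fun _ _ => abs_nonneg _) (Finset.mem_univ a)

/-- Rescaled boundary data of low rank has small tangential area. -/
lemma exists_tangential_area_bound {f : κ → Euc n → ℝ} (hf : ∀ a, ContDiff ℝ 2 (f a)) {r : ℕ}
    (hrank : ∀ x, ‖x‖ = 1 ∨ ‖x‖ = 2 → (jac f x).rank ≤ r) :
    ∃ A : ℝ, 1 ≤ A ∧ ∀ R : ℝ, 1 ≤ R → ∀ x, ‖x‖ = 1 ∨ ‖x‖ = 2 →
      area (jac (fun a y => R * f a y) x * tangProj x) ≤ A * R ^ r := by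
  obtain ⟨c, hc0, hc⟩ := exists_tangential_jac_bound hf
  refine ⟨√((1 + c) ^ r), Real.one_le_sqrt.2 (one_le_pow₀ (by linarith)), fun R hR x hx => ?_⟩
  have hJ : jac (fun a y => R * f a y) x = R • jac f x := by
    ext a i
    exact partialD_const_mul ((hf a).differentiable (by norm_num)) R i x
  have hT : jac (fun a y => R * f a y) x * tangProj x = jac f x * (R • tangProj x) := by
    rw [hJ, Matrix.smul_mul, Matrix.mul_smul]
  have hsum : ∑ a, ∑ i, (jac f x * (R • tangProj x)) a i ^ 2 ≤ R ^ 2 * c := by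
    simp only [Matrix.mul_smul, Matrix.smul_apply, smul_eq_mul, mul_pow, ← Finset.mul_sum]
    exact mul_le_mul_of_nonneg_left (hc x hx) (sq_nonneg R)
  have hdet := det_graphMetric_le_of_rank_le (jac f x * (R • tangProj x))
    ((Matrix.rank_mul_le_left _ _).trans (hrank x hx)) hsum
  rw [hT, area]
  refine Real.sqrt_le_iff.2 ⟨by positivity, hdet.trans ?_⟩
  rw [mul_pow, Real.sq_sqrt (by positivity), ← pow_mul, mul_comm r 2, pow_mul, ← mul_pow]
  refine pow_le_pow_left₀ (by positivity) ?_ r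
  nlinarith [one_le_pow₀ hR (n := 2)]

/-- The graph of a solution with largely rescaled low-rank boundary data stays close to
the boundary of the graph. -/
theorem exists_forall_isMinimal_near_boundary (hn : 1 ≤ n) {f : κ → Euc n → ℝ}
    (hf : ∀ a, ContDiff ℝ 2 (f a))
    (hrank : ∀ x, ‖x‖ = 1 ∨ ‖x‖ = 2 → (jac f x).rank ≤ n - 1) {ρ : ℝ} (hρ : 0 < ρ) :
    ∃ R₀ > (0 : ℝ), ∀ R ≥ R₀, ∀ F : κ → Euc n → ℝ, IsMinimal F →
      (∀ a x, ‖x‖ = 1 ∨ ‖x‖ = 2 → F a x = R * f a x) →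
      ∀ᵐ x₀ : Euc n, x₀ ∈ annulus n → ∃ x, (‖x‖ = 1 ∨ ‖x‖ = 2) ∧
        ∑ a, (F a x - F a x₀) * (F a x - F a x₀) < (ρ * R) ^ 2 := by
  obtain ⟨A, hA1, hA⟩ := exists_tangential_area_bound hf hrank
  obtain ⟨C, hC0, hC⟩ := exists_layer_bound n
  set v := volume.real (Metric.ball (0 : Euc n) 1) with hv
  have hv0 : 0 < v := ENNReal.toReal_pos (Metric.measure_ball_pos _ _ one_pos).ne'
    measure_ball_lt_top.ne
  set B : ℝ := 24 * A / ρ ^ n with hB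
  have hB0 : 0 < B := by positivity
  refine ⟨1 + B * C / (v / 2 ^ (n + 4)), by positivity, fun R hR F hF hFf => ?_⟩
  have hR1 : 1 ≤ R := le_trans (le_add_of_nonneg_right (by positivity)) hR
  have hR0 : 0 < R := by linarith
  filter_upwards [hF.ae_le_integral_area] with x₀ hx₀ hx₀A
  obtain ⟨τ, hτ, hd⟩ := hx₀ hx₀A
  by_contra! hfar
  have key := hF.integral_area_le (f := fun a x => R * f a x) (x₀ := x₀) (c := fun a => F a x₀)
    (fun a => contDiff_const.mul (hf a)) hFf hτ hC0 hC (b := B / R) (by positivity) ?_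
  · have h1 : (1 : ℝ) ≤ ((n + 1 : ℕ) : ℝ) := by
      push_cast
      linarith [(Nat.cast_nonneg n : (0 : ℝ) ≤ n)]
    have h2 : v / 2 ^ (n + 4) ≤ B / R * C := hd.trans
      ((le_mul_of_one_le_left (le_trans (by positivity) hd) h1).trans key)
    have h3 : 0 < v / 2 ^ (n + 4) := by positivity
    have h4 : B * C / (v / 2 ^ (n + 4)) < R := by linarith
    rw [div_lt_iff₀ h3] at h4
    rw [div_mul_eq_mul_div, le_div_iff₀ hR0] at h2
    linarith
  · intro x hx
    have hs : |radialSlope x| ≤ 12 := by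
      rcases hx with h | h <;> rw [radialSlope, normSq_eq, h] <;> norm_num
    have hρR : ρ * R ≤ regDist F x₀ (fun a => F a x₀) τ x := by
      refine Real.le_sqrt_of_sq_le ((hfar x hx).trans ?_)
      have : 0 ≤ ∑ j, (x j - x₀ j) * (x j - x₀ j) :=
        Finset.sum_nonneg fun _ _ => mul_self_nonneg _
      rw [sepSq]
      linarith [sq_nonneg τ]
    have hq : √(sepSq F x₀ (fun a => F a x₀) x) /
        regDist F x₀ (fun a => F a x₀) τ x ^ (n + 1) ≤ ((ρ * R) ^ n)⁻¹ :=
      (sqrt_sepSq_div_le hτ x).trans (by gcongr)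
    have hq0 : 0 ≤ √(sepSq F x₀ (fun a => F a x₀) x) /
        regDist F x₀ (fun a => F a x₀) τ x ^ (n + 1) :=
      div_nonneg (Real.sqrt_nonneg _) (pow_nonneg (regDist_pos hτ x).le _)
    have hAR : 1 ≤ A * R ^ (n - 1) := one_le_mul_of_one_le_of_one_le hA1 (one_le_pow₀ hR1)
    have hpow : R ^ n = R ^ (n - 1) * R := (pow_sub_one_mul (by omega) R).symm
    calc _ ≤ 12 * (A * R ^ (n - 1) + A * R ^ (n - 1)) * ((ρ * R) ^ n)⁻¹ := by
          gcongr
          · have := one_le_area (jac (fun a y => R * f a y) x * tangProj x)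
            positivity
          · exact hA R hR1 x hx
      _ = B / R := by
          rw [hB, mul_pow, hpow]
          field_simp
          ring
      _ ≤ B / R * ∑ i, defGrad i x ^ 2 := by
          refine le_mul_of_one_le_right (by positivity) ?_
          linarith [sum_sq_defGrad_ge hx]

end Obstruction

section Reduction

open scoped NNReal Manifold ContDiff
open Filter Topology Set

variable {n : ℕ}

/-- A function that is `C²` around a closed set agrees near it with a global `C²` function. -/
lemma exists_contDiff_extension {S : Set (Euc n)} (hS : IsClosed S) {g : Euc n → ℝ}
    (hg : ∀ x ∈ S, ContDiffAt ℝ 2 g x) :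
    ∃ h : Euc n → ℝ, ContDiff ℝ 2 h ∧ ∀ x ∈ S, h =ᶠ[𝓝 x] g := by
  set U : Set (Euc n) := {x | ContDiffAt ℝ 2 g x} with hU
  have hUo : IsOpen U := isOpen_iff_mem_nhds.2 fun x (hx : ContDiffAt ℝ 2 g x) =>
    ContDiffAt.eventually hx (by norm_num)
  obtain ⟨χ, h0, h1, -⟩ := exists_contMDiffMap_zero_one_nhds_of_isClosed (𝓘(ℝ, Euc n)) (n := 2)
    hUo.isClosed_compl hS (disjoint_left.2 fun x hx hxS => hx (hg x hxS))
  refine ⟨fun x => χ x * g x, contDiff_iff_contDiffAt.2 fun x => ?_, fun x hx => ?_⟩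
  · by_cases hx : x ∈ U
    · exact χ.contMDiff.contDiff.contDiffAt.mul hx
    · have h : (fun x => χ x * g x) =ᶠ[𝓝 x] fun _ => 0 := by
        filter_upwards [eventually_nhdsSet_iff_forall.1 h0 x hx] with y hy
        rw [hy, zero_mul]
      exact contDiffAt_const.congr_of_eventuallyEq h
  · filter_upwards [eventually_nhdsSet_iff_forall.1 h1 x hx] with y hy
    rw [hy, one_mul]

lemma rank_jac_eq_finrank_range {m : ℕ} {f : Euc n → Euc m} {x : Euc n}
    (hf : DifferentiableAt ℝ f x) :
    (jac (fun a y => f y a) x).rank =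
      Module.finrank ℝ (LinearMap.range (fderiv ℝ f x : Euc n →ₗ[ℝ] Euc m)) := by
  have h : (jac (fun a y => f y a) x).mulVecLin =
      (WithLp.linearEquiv 2 ℝ (Fin (m + 1) → ℝ)).toLinearMap ∘ₗ
        (fderiv ℝ f x : Euc n →ₗ[ℝ] Euc m) ∘ₗ
          (WithLp.linearEquiv 2 ℝ (Fin (n + 1) → ℝ)).symm.toLinearMap := by
    refine LinearMap.ext fun v => funext fun a => ?_
    have h1 := fderiv_apply_eq_sum (fun y => f y a) x (WithLp.toLp 2 v)
    have h2 : HasFDerivAt (fun y => f y a) ((EuclideanSpace.proj a).comp (fderiv ℝ f x)) x :=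
      (EuclideanSpace.proj (𝕜 := ℝ) a).hasFDerivAt.comp x hf.hasFDerivAt
    rw [h2.fderiv] at h1
    simpa [Matrix.mulVec, dotProduct, jac] using h1.symm
  rw [Matrix.rank, h, LinearMap.range_comp, LinearMap.range_comp, LinearEquiv.range,
    Submodule.map_top]
  exact LinearEquiv.finrank_map_eq (WithLp.linearEquiv 2 ℝ (Fin (m + 1) → ℝ)) _

lemma mem_frontier_annulus {x : Euc n} (hx : ‖x‖ = 1 ∨ ‖x‖ = 2) : x ∈ frontier (annulus n) := by
  rw [isOpen_annulus.frontier_eq]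
  have hlim : Tendsto (fun t : ℝ => t • x) (𝓝 1) (𝓝 x) := by
    have : Continuous fun t : ℝ => t • x := by fun_prop
    simpa using this.tendsto 1
  refine ⟨?_, fun h => ?_⟩
  · rcases hx with h | h
    · refine mem_closure_of_tendsto (hlim.mono_left (nhdsWithin_le_nhds (s := Ioi 1))) ?_
      filter_upwards [Ioo_mem_nhdsGT (show (1 : ℝ) < 2 by norm_num)] with t ht
      constructor <;> rw [norm_smul, h, Real.norm_eq_abs, abs_of_pos (by linarith [ht.1])] <;>
        linarith [ht.1, ht.2]
    · refine mem_closure_of_tendsto (hlim.mono_left (nhdsWithin_le_nhds (s := Iio 1))) ?_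
      filter_upwards [Ioo_mem_nhdsLT (show (1 / 2 : ℝ) < 1 by norm_num)] with t ht
      constructor <;> rw [norm_smul, h, Real.norm_eq_abs, abs_of_pos (by linarith [ht.1])] <;>
        linarith [ht.1, ht.2]
  · obtain ⟨h1, h2⟩ := h
    rcases hx with h | h <;> linarith

/-- A map that separates the two boundary spheres has interior values far from all its boundary
values. -/
lemma exists_isOpen_far_from_boundary {E : Type*} [PseudoMetricSpace E] {G : Euc n → E}
    (hG : Continuous G) {s : ℝ} (hs : 0 < s)
    (hsep : ∀ x y, ‖x‖ = 1 → ‖y‖ = 2 → s ≤ dist (G x) (G y)) :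
    ∃ U, IsOpen U ∧ U.Nonempty ∧ U ⊆ annulus n ∧
      ∀ x₀ ∈ U, ∀ x, ‖x‖ = 1 ∨ ‖x‖ = 2 → s / 4 ≤ dist (G x) (G x₀) := by
  set e : Euc n := EuclideanSpace.single 0 1 with he
  have hen : ‖e‖ = 1 := by simp [he]
  set K : Set E := G '' Metric.sphere 0 1 with hK
  set L : Set E := G '' {x | ‖x‖ = 1 ∨ ‖x‖ = 2} with hL
  have heK : G e ∈ K := mem_image_of_mem G (by simp [hen])
  have hKne : K.Nonempty := ⟨_, heK⟩
  have hLne : L.Nonempty := ⟨_, mem_image_of_mem G (Or.inl hen)⟩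
  have hfar : ∀ y, ‖y‖ = 2 → s ≤ Metric.infDist (G y) K := fun y hy =>
    (Metric.le_infDist hKne).2 (by
      rintro _ ⟨x, hx, rfl⟩
      rw [dist_comm]
      exact hsep x y (by simpa using hx) hy)
  have hcont : Continuous fun t : ℝ => Metric.infDist (G (t • e)) K :=
    (Metric.continuous_infDist_pt K).comp (hG.comp (by fun_prop))
  have h1 : Metric.infDist (G ((1 : ℝ) • e)) K = 0 := by
    rw [one_smul]
    exact Metric.infDist_zero_of_mem heK
  have h2 : s ≤ Metric.infDist (G ((2 : ℝ) • e)) K := hfar _ (by rw [norm_smul, hen]; norm_num)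
  obtain ⟨t, ht, hts⟩ := intermediate_value_Ioo (show (1 : ℝ) ≤ 2 by norm_num) hcont.continuousOn
    (show s / 2 ∈ Ioo _ _ from ⟨by rw [h1]; linarith, by linarith⟩)
  simp only at hts
  refine ⟨annulus n ∩ {x | s / 4 < Metric.infDist (G x) L}, isOpen_annulus.inter
    (isOpen_lt continuous_const ((Metric.continuous_infDist_pt L).comp hG)), ⟨t • e, ?_, ?_⟩,
    inter_subset_left, fun x₀ hx₀ x hx => ?_⟩
  · constructor <;> rw [norm_smul, hen, Real.norm_eq_abs, abs_of_pos (by linarith [ht.1])] <;>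
      linarith [ht.1, ht.2]
  · refine lt_of_lt_of_le (show s / 4 < s / 2 by linarith) ((Metric.le_infDist hLne).2 ?_)
    rintro _ ⟨x, hx | hx, rfl⟩
    · rw [← hts]
      exact Metric.infDist_le_dist_of_mem (mem_image_of_mem G (by simpa using hx))
    · have := Metric.infDist_le_infDist_add_dist (s := K) (x := G x) (y := G (t • e))
      rw [dist_comm]
      linarith [hfar x hx]
  · rw [dist_comm]
    exact hx₀.2.le.trans (Metric.infDist_le_dist_of_mem (mem_image_of_mem G hx))

lemma mssMetric_eq_graphMetric {m : ℕ} {F : Euc n → Euc m} {x : Euc n}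
    {G : Fin (m + 1) → Euc n → ℝ}
    (h : ∀ a i, fderiv ℝ F x (EuclideanSpace.single i 1) a = partialD i (G a) x) :
    mssMetric F x = graphMetric (jac G x) := by
  ext i j
  simp [mssMetric, graphMetric, Matrix.one_apply, Matrix.mul_apply, jac, h]

/-- The components of a solution extend to globally Lipschitz functions. -/
lemma IsMSSolution.exists_isMinimal {m : ℕ} {f F : Euc n → Euc m}
    (hF : IsMSSolution n m (annulus n) f F) :
    ∃ G : Fin (m + 1) → Euc n → ℝ, IsMinimal G ∧ ∀ a x, ‖x‖ = 1 ∨ ‖x‖ = 2 → G a x = f x a := by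
  obtain ⟨hc, ⟨K, hK⟩, hb, hw⟩ := hF
  have hext : ∀ a, ∃ g : Euc n → ℝ, LipschitzWith K g ∧ EqOn (fun x => F x a) g (annulus n) :=
    fun a => LipschitzOnWith.extend_real (LipschitzOnWith.of_dist_le_mul fun x hx y hy =>
      (by
        rw [Real.dist_eq, ← Real.norm_eq_abs, ← PiLp.sub_apply, dist_eq_norm]
        exact PiLp.norm_apply_le (F x - F y) a : dist (F x a) (F y a) ≤ dist (F x) (F y)).trans
        (hK.dist_le_mul x hx y hy))
  choose G hGl hGF using hext
  have hd : ∀ᵐ x : Euc n, x ∈ annulus n →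
      ∀ a i, fderiv ℝ F x (EuclideanSpace.single i 1) a = partialD i (G a) x := by
    filter_upwards [ae_all_iff.2 fun a => (hGl a).ae_differentiableAt] with x hx hxA a i
    have hFG : ∀ a, (fun y => F y a) =ᶠ[𝓝 x] G a := fun a => by
      filter_upwards [isOpen_annulus.mem_nhds hxA] with y hy using hGF a hy
    have hFd : DifferentiableAt ℝ F x :=
      differentiableAt_euclidean.2 fun a => (hx a).congr_of_eventuallyEq (hFG a)
    have h2 : HasFDerivAt (fun y => F y a) ((EuclideanSpace.proj a).comp (fderiv ℝ F x)) x :=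
      (EuclideanSpace.proj (𝕜 := ℝ) a).hasFDerivAt.comp x hFd.hasFDerivAt
    rw [partialD, ← (hFG a).fderiv_eq, h2.fderiv]
    rfl
  refine ⟨G, ⟨⟨K, hGl⟩, fun φ h1 h2 h3 j => ?_, fun φ h1 h2 h3 a => ?_⟩, fun a x hx => ?_⟩
  · rw [← (hw φ h1 h2 h3).1 j]
    refine setIntegral_congr_ae measurableSet_annulus ?_
    filter_upwards [hd] with x hx hxA
    rw [mssMetric_eq_graphMetric (hx hxA)]
    rfl
  · rw [← (hw φ h1 h2 h3).2 a]
    refine setIntegral_congr_ae measurableSet_annulus ?_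
    filter_upwards [hd] with x hx hxA
    rw [mssMetric_eq_graphMetric (hx hxA)]
    simp only [hx hxA, Finset.sum_mul]
    rfl
  · have hxf := mem_frontier_annulus hx
    have hcl : EqOn (fun x => F x a) (G a) (closure (annulus n)) :=
      (hGF a).of_subset_closure ((EuclideanSpace.proj (𝕜 := ℝ) a).continuous.comp_continuousOn hc)
        (hGl a).continuous.continuousOn subset_closure subset_rfl
    rw [← hcl (frontier_subset_closure hxf)]
    simp only [hb x hxf]

end Reduction

/-- Non-existence over the annulus `1 < ‖x‖ < 2` of solutions with strongly rescaled
boundary data `R·f₁` on `Sⁿ(1)` and `R·f₂` on `Sⁿ(2)`, when the boundary maps have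
differentials of rank lower than `n` and disjoint images. -/
theorem annulus_nonexistence_disjoint_images (n m : ℕ) (hn : 1 ≤ n) (hm : 1 ≤ m)
    (f₁ f₂ : EuclideanSpace ℝ (Fin (n+1)) → EuclideanSpace ℝ (Fin (m+1)))
    (V₁ : Set (EuclideanSpace ℝ (Fin (n+1)))) (hV₁open : IsOpen V₁)
    (hSV₁ : Metric.sphere (0 : EuclideanSpace ℝ (Fin (n+1))) 1 ⊆ V₁)
    (hf₁C2 : ContDiffOn ℝ 2 f₁ V₁)
    (V₂ : Set (EuclideanSpace ℝ (Fin (n+1)))) (hV₂open : IsOpen V₂)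
    (hSV₂ : Metric.sphere (0 : EuclideanSpace ℝ (Fin (n+1))) 2 ⊆ V₂)
    (hf₂C2 : ContDiffOn ℝ 2 f₂ V₂)
    (l₁ l₂ : ℕ) (hl₁ : l₁ < n) (hl₂ : l₂ < n)
    (hrank₁ : ∀ x ∈ Metric.sphere (0 : EuclideanSpace ℝ (Fin (n+1))) 1,
      Module.finrank ℝ
        (LinearMap.range ((fderiv ℝ f₁ x : EuclideanSpace ℝ (Fin (n+1)) →L[ℝ]
          EuclideanSpace ℝ (Fin (m+1))) :
            EuclideanSpace ℝ (Fin (n+1)) →ₗ[ℝ] EuclideanSpace ℝ (Fin (m+1)))) ≤ l₁)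
    (hrank₂ : ∀ x ∈ Metric.sphere (0 : EuclideanSpace ℝ (Fin (n+1))) 2,
      Module.finrank ℝ
        (LinearMap.range ((fderiv ℝ f₂ x : EuclideanSpace ℝ (Fin (n+1)) →L[ℝ]
          EuclideanSpace ℝ (Fin (m+1))) :
            EuclideanSpace ℝ (Fin (n+1)) →ₗ[ℝ] EuclideanSpace ℝ (Fin (m+1)))) ≤ l₂)
    (hdisj : Disjoint (f₁ '' Metric.sphere (0 : EuclideanSpace ℝ (Fin (n+1))) 1)
      (f₂ '' Metric.sphere (0 : EuclideanSpace ℝ (Fin (n+1))) 2)) :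
    ∃ R₀ > (0:ℝ), ∀ R ≥ R₀,
      ¬ ∃ F, IsMSSolution n m {x : EuclideanSpace ℝ (Fin (n+1)) | 1 < ‖x‖ ∧ ‖x‖ < 2}
        (fun x => if ‖x‖ ≤ (3/2 : ℝ) then R • f₁ x else R • f₂ x) F := by
  set S : Set (Euc n) := {x | ‖x‖ = 1 ∨ ‖x‖ = 2} with hS
  have hSc : IsClosed S :=
    (isClosed_eq continuous_norm continuous_const).union (isClosed_eq continuous_norm continuous_const)
  set g : Euc n → Euc m := fun x => if ‖x‖ ≤ (3/2 : ℝ) then f₁ x else f₂ x with hg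
  have hg₁ : ∀ x : Euc n, ‖x‖ = 1 → g =ᶠ[nhds x] f₁ := fun x hx => by
    filter_upwards [continuous_norm.continuousAt.eventually_lt continuousAt_const
      (show ‖x‖ < 3 / 2 by rw [hx]; norm_num)] with y hy
    exact if_pos hy.le
  have hg₂ : ∀ x : Euc n, ‖x‖ = 2 → g =ᶠ[nhds x] f₂ := fun x hx => by
    filter_upwards [continuousAt_const.eventually_lt continuous_norm.continuousAt
      (show 3 / 2 < ‖x‖ by rw [hx]; norm_num)] with y hy
    exact if_neg hy.not_ge
  have hg2 : ∀ x ∈ S, ContDiffAt ℝ 2 g x := by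
    rintro x (hx | hx)
    · exact (hf₁C2.contDiffAt (hV₁open.mem_nhds (hSV₁ (by simpa using hx)))).congr_of_eventuallyEq
        (hg₁ x hx)
    · exact (hf₂C2.contDiffAt (hV₂open.mem_nhds (hSV₂ (by simpa using hx)))).congr_of_eventuallyEq
        (hg₂ x hx)
  choose f hf hfg using fun a : Fin (m + 1) =>
    exists_contDiff_extension hSc fun x hx => contDiffAt_euclidean.1 (hg2 x hx) a
  have hrank : ∀ x, ‖x‖ = 1 ∨ ‖x‖ = 2 → (jac f x).rank ≤ n - 1 := by
    intro x hx
    have hjac : jac f x = jac (fun a y => g y a) x := by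
      ext a i
      exact congrArg (fun L : Euc n →L[ℝ] ℝ => L (EuclideanSpace.single i 1)) (hfg a x hx).fderiv_eq
    rw [hjac, rank_jac_eq_finrank_range ((hg2 x hx).differentiableAt (by norm_num))]
    rcases hx with hx | hx
    · rw [(hg₁ x hx).fderiv_eq]
      exact (hrank₁ x (by simpa using hx)).trans (by omega)
    · rw [(hg₂ x hx).fderiv_eq]
      exact (hrank₂ x (by simpa using hx)).trans (by omega)
  have hcompact : ∀ (h : Euc n → Euc m) (V : Set (Euc n)) (r : ℝ), Metric.sphere 0 r ⊆ V →
      ContDiffOn ℝ 2 h V → IsCompact (h '' Metric.sphere 0 r) := fun h V r hV hh =>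
    (isCompact_sphere 0 r).image_of_continuousOn (hh.continuousOn.mono hV)
  obtain ⟨δ, hδ0, hδ⟩ := Metric.exists_pos_forall_lt_edist (hcompact f₁ V₁ 1 hSV₁ hf₁C2)
    (hcompact f₂ V₂ 2 hSV₂ hf₂C2).isClosed hdisj
  have hsep : ∀ x y : Euc n, ‖x‖ = 1 → ‖y‖ = 2 → (δ : ℝ) ≤ dist (g x) (g y) := by
    intro x y hx hy
    rw [(hg₁ x hx).eq_of_nhds, (hg₂ y hy).eq_of_nhds]
    have h := hδ _ (Set.mem_image_of_mem f₁ (by simpa using hx)) _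
      (Set.mem_image_of_mem f₂ (by simpa using hy))
    rw [edist_nndist, ENNReal.coe_lt_coe] at h
    exact_mod_cast h.le
  have hδ' : (0 : ℝ) < δ := hδ0
  obtain ⟨R₀, hR₀, hnear⟩ := exists_forall_isMinimal_near_boundary hn hf hrank
    (show (0 : ℝ) < δ / 4 by positivity)
  refine ⟨R₀, hR₀, fun R hR => ?_⟩
  rintro ⟨F, hF⟩
  have hR0 : 0 < R := hR₀.trans_le hR
  obtain ⟨G, hG, hGb⟩ := IsMSSolution.exists_isMinimal hF
  have hGg : ∀ a x, ‖x‖ = 1 ∨ ‖x‖ = 2 → G a x = R * g x a := by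
    intro a x hx
    rw [hGb a x hx, hg]
    dsimp only
    split_ifs <;> simp
  have hGf : ∀ a x, ‖x‖ = 1 ∨ ‖x‖ = 2 → G a x = R * f a x := fun a x hx => by
    rw [hGg a x hx, (hfg a x hx).eq_of_nhds]
  set H : Euc n → Euc m := fun x => WithLp.toLp 2 fun a => G a x with hH
  obtain ⟨K, hK⟩ := hG.lipschitz
  have hHc : Continuous H := (PiLp.continuous_toLp 2 _).comp
    (continuous_pi fun a => (hK a).continuous)
  have hHg : ∀ x, ‖x‖ = 1 ∨ ‖x‖ = 2 → H x = R • g x := fun x hx => by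
    ext a
    simpa [hH] using hGg a x hx
  obtain ⟨U, hUo, hUne, hUA, hU⟩ := exists_isOpen_far_from_boundary hHc (s := R * δ)
    (by positivity) fun x y hx hy => by
      rw [hHg x (Or.inl hx), hHg y (Or.inr hy), dist_smul₀, Real.norm_of_nonneg hR0.le]
      exact mul_le_mul_of_nonneg_left (hsep x y hx hy) hR0.le
  have hae := hnear R hR G hG hGf
  obtain ⟨x₀, hx₀U, hx₀⟩ := (Measure.dense_of_ae hae).inter_open_nonempty U hUo hUne
  obtain ⟨x, hx, hlt⟩ := hx₀ (hUA hx₀U)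
  have hd := hU x₀ hx₀U x hx
  have hsq : dist (H x) (H x₀) ^ 2 = ∑ a, (G a x - G a x₀) * (G a x - G a x₀) := by
    rw [EuclideanSpace.dist_eq, Real.sq_sqrt (Finset.sum_nonneg fun _ _ => sq_nonneg _)]
    simp [hH, Real.dist_eq, sq]
  rw [← hsq] at hlt
  have := pow_le_pow_left₀ (by positivity) hd 2
  have h4 : δ / 4 * R = R * δ / 4 := by ring
  rw [h4] at hlt
  exact absurd hlt (not_lt.2 this)
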